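/- arXiv:1807.03475 — 4 statements merged into one kernel-verified Lean document; each statement's English description precedes it below -/
import Mathlib

section
/- For every k_e > 0 there exist b > 0 and r > 0 such that for every R ∈ ℝ^{3×3} satisfying (k_e/4)·‖RᵀR − I‖² < r, one has b·(k_e/4)·‖RᵀR − I‖² ≤ k_e²·‖R(RᵀR − I)‖². -/
open Matrix

attribute [local instance] Matrix.frobeniusNormedAddCommGroup Matrix.frobeniusNormedSpace

noncomputable section

abbrev Mat3 := Matrix (Fin 3) (Fin 3) ℝ

/-- Frobenius inner product `⟨A,B⟩ = tr(AᵀB)`. -/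
def finner (A B : Mat3) : ℝ := (Aᵀ * B).trace

/-- The hat map `∧ : ℝ³ → ℝ^{3×3}`. -/
def hat (v : Fin 3 → ℝ) : Mat3 :=
  !![0, -v 2, v 1; v 2, 0, -v 0; -v 1, v 0, 0]

/-- The cross product on ℝ³. -/
def cross (u v : Fin 3 → ℝ) : Fin 3 → ℝ :=
  ![u 1 * v 2 - u 2 * v 1, u 2 * v 0 - u 0 * v 2, u 0 * v 1 - u 1 * v 0]

/-- `SO(3)`: rotation matrices. -/
def SO3 : Set Mat3 := {R | Rᵀ * R = 1 ∧ 0 < R.det}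

theorem frob_sq_aux (A : Mat3) : ‖A‖ ^ 2 = ∑ i, ∑ j, A i j ^ 2 := by
  rw [Matrix.frobenius_norm_def, ← Real.sqrt_eq_rpow, Real.sq_sqrt (by positivity)]
  simp

theorem frob_R_aux (R : Mat3) (h : ‖Rᵀ * R - 1‖ ≤ 1 / 2) : ‖R‖ ≤ 3 := by
  have hd : ∀ j, (Rᵀ * R) j j ≤ 2 := by
    intro j
    have h1 : ((Rᵀ * R - 1) j j) ^ 2 ≤ ‖Rᵀ * R - 1‖ ^ 2 := by
      rw [frob_sq_aux]
      refine le_trans ?_ (Finset.single_le_sum (f := fun i => ∑ k, (Rᵀ * R - 1) i k ^ 2)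
        (fun i _ => by positivity) (Finset.mem_univ j))
      exact Finset.single_le_sum (f := fun k => (Rᵀ * R - 1) j k ^ 2)
        (fun i _ => by positivity) (Finset.mem_univ j)
    have h2 := abs_le_of_sq_le_sq' h1 (norm_nonneg _)
    rw [Matrix.sub_apply, Matrix.one_apply_eq] at h2
    linarith [h2.2]
  have h0 := hd 0
  have h1 := hd 1
  have h2 := hd 2
  have hR := frob_sq_aux R
  simp only [Matrix.mul_apply, Matrix.transpose_apply, Fin.sum_univ_three] at h0 h1 h2 hR
  nlinarith [norm_nonneg R]

/-- The transversal stabilizing potential `Ṽ(R) = (k_e/4)‖RᵀR − I‖²` for SO(3)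
satisfies `b·Ṽ(R) ≤ ‖∇Ṽ(R)‖² = k_e²‖R(RᵀR − I)‖²` on a sublevel set `Ṽ < r`. -/
theorem gradient_domination_SO3_potential (ke : ℝ) (hke : 0 < ke) :
    ∃ b > (0:ℝ), ∃ r > (0:ℝ), ∀ R : Mat3,
      ke / 4 * ‖Rᵀ * R - 1‖ ^ 2 < r →
        b * (ke / 4 * ‖Rᵀ * R - 1‖ ^ 2) ≤ ke ^ 2 * ‖R * (Rᵀ * R - 1)‖ ^ 2 := by
  refine ⟨ke / 9, by positivity, ke / 16, by positivity, fun R hR => ?_⟩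
  have hE : ‖Rᵀ * R - 1‖ ≤ 1 / 2 := by
    have : ‖Rᵀ * R - 1‖ ^ 2 < 1 / 4 := by
      by_contra! hc
      nlinarith
    nlinarith [norm_nonneg (Rᵀ * R - 1)]
  have hR3 := frob_R_aux R hE
  have hid : Rᵀ * R - 1 = Rᵀ * (R * (Rᵀ * R - 1)) - (Rᵀ * R - 1) * (Rᵀ * R - 1) := by
    noncomm_ring
  have h1 : ‖Rᵀ * R - 1‖ ≤ ‖Rᵀ * (R * (Rᵀ * R - 1))‖ + ‖(Rᵀ * R - 1) * (Rᵀ * R - 1)‖ := by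
    conv_lhs => rw [hid]
    exact norm_sub_le _ _
  have h2 := Matrix.frobenius_norm_mul Rᵀ (R * (Rᵀ * R - 1))
  have h3 := Matrix.frobenius_norm_mul (Rᵀ * R - 1) (Rᵀ * R - 1)
  rw [Matrix.frobenius_norm_transpose] at h2
  generalize ‖Rᵀ * (R * (Rᵀ * R - 1))‖ = c at *
  generalize ‖(Rᵀ * R - 1) * (Rᵀ * R - 1)‖ = d at *
  have hx := norm_nonneg (R * (Rᵀ * R - 1))
  have he := norm_nonneg (Rᵀ * R - 1)
  generalize ‖R * (Rᵀ * R - 1)‖ = x at *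
  generalize ‖Rᵀ * R - 1‖ = e at *
  have h4 : e ≤ 6 * x := by nlinarith
  have h5 : e ^ 2 ≤ 36 * x ^ 2 := by nlinarith
  nlinarith [mul_le_mul_of_nonneg_left h5 (sq_nonneg ke)]

end
end

section
/- Let k_e > 0 and let Ω₀ : [0,∞) → ℝ³ be differentiable and bounded, with u₀ = Ω̇₀ bounded. Let K_P, K_D, K_I ∈ ℝ^{3×3} be such that the real polynomial λ ↦ det(λ³ I + λ² K_D + λ K_P + K_I) is Hurwitz. Then there exist constants C > 0 and λ > 0 such that every solution (Z_s, z, ω) : [0,∞) → Sym(ℝ^{3×3}) × ℝ³ × ℝ³ of the closed-loop system Ż_s = [Z_s, Ω̂₀(t)] − 2k_e Z_s, ż = z × Ω₀(t) + ω, ω̇(t) = −K_P z(t) − K_D (z(t) × Ω₀(t) + ω(t)) − K_I ∫₀ᵗ z(τ) dτ − (z(t) × Ω₀(t) + ω(t)) × Ω₀(t) − z(t) × u₀(t), satisfies ‖Z_s(t)‖ + ‖z(t)‖ + ‖ω(t)‖ ≤ C·e^{−λt}·(‖Z_s(0)‖ + ‖z(0)‖ + ‖ω(0)‖) for all t ≥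 0. -/
open Matrix

attribute [local instance] Matrix.frobeniusNormedAddCommGroup Matrix.frobeniusNormedSpace

noncomputable section

/-- Euclidean norm on ℝ³. -/
def enorm3 (v : Fin 3 → ℝ) : ℝ := Real.sqrt (∑ i, v i ^ 2)

/-- The vee map, inverse of the hat map on skew-symmetric matrices. -/
def vee (A : Mat3) : Fin 3 → ℝ := ![A 2 1, A 0 2, A 1 0]

/-- Symmetrization operator. -/
def symPart (A : Mat3) : Mat3 := (2⁻¹ : ℝ) • (A + Aᵀ)

/-- Skew-symmetrization operator. -/
def skewPart (A : Mat3) : Mat3 := (2⁻¹ : ℝ) • (A - Aᵀ)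

/-- The matrix commutator. -/
def mcomm (A B : Mat3) : Mat3 := A * B - B * A

/-- A real square matrix is Hurwitz if every complex eigenvalue (root of its
characteristic polynomial over ℂ) has negative real part. -/
def IsHurwitzMat {n : Type*} [Fintype n] [DecidableEq n] (M : Matrix n n ℝ) : Prop :=
  ∀ μ : ℂ, (M.map (algebraMap ℝ ℂ)).charpoly.eval μ = 0 → μ.re < 0

/-- A real polynomial is Hurwitz if all of its complex roots have negative real part. -/
def IsHurwitzPoly (p : Polynomial ℝ) : Prop :=
  ∀ μ : ℂ, (p.map (algebraMap ℝ ℂ)).eval μ = 0 → μ.re < 0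

open Set in
theorem aux_step {E : Type*} [NormedAddCommGroup E] [NormedSpace ℂ E] (μ : ℂ) (lam K : ℝ)
    (hμ : μ.re < -lam) (hK : 0 ≤ K) (x y : ℝ → E)
    (hx : ∀ t, 0 ≤ t → HasDerivWithinAt x (μ • x t + y t) (Ici 0) t)
    (hy : ∀ t, 0 ≤ t → ‖y t‖ ≤ K * Real.exp (-lam * t)) (t : ℝ) (ht : 0 ≤ t) :
    ‖x t‖ ≤ (‖x 0‖ + K / (-lam - μ.re)) * Real.exp (-lam * t) := by
  set d := -lam - μ.re with hd
  have hd0 : 0 < d := by linarith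
  have hexp : ∀ s : ℝ, HasDerivAt (fun s : ℝ => Complex.exp (-μ * s)) (Complex.exp (-μ * s) * (-μ)) s := by
    intro s
    have h1 : HasDerivAt (fun s : ℝ => -μ * (s : ℂ)) (-μ) s := by
      simpa using (Complex.ofRealCLM.hasDerivAt (x := s)).const_mul (-μ)
    exact h1.cexp
  have hnexp : ∀ s : ℝ, ‖Complex.exp (-μ * s)‖ = Real.exp (-μ.re * s) := by
    intro s
    rw [Complex.norm_exp]; simp
  have hf : ∀ s : ℝ, 0 ≤ s → HasDerivWithinAt (fun s : ℝ => Complex.exp (-μ * s) • x s)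
      (Complex.exp (-μ * s) • y s) (Ici 0) s := by
    intro s hs
    have := (hexp s).hasDerivWithinAt.smul (hx s hs)
    refine this.congr_deriv ?_
    simp only [smul_add, smul_smul, mul_neg, neg_smul]
    abel
  have hB : ∀ s : ℝ, HasDerivAt (fun s : ℝ => ‖x 0‖ + K / d * (Real.exp (d * s) - 1))
      (K * Real.exp (d * s)) s := by
    intro s
    have h1 : HasDerivAt (fun s : ℝ => d * s) d s := by
      simpa using (hasDerivAt_id s).const_mul d
    refine (((h1.exp.sub_const 1).const_mul (K / d)).const_add (‖x 0‖)).congr_deriv ?_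
    field_simp
  have key := image_norm_le_of_norm_deriv_right_le_deriv_boundary (a := 0) (b := t)
    (f := fun s : ℝ => Complex.exp (-μ * s) • x s) (f' := fun s : ℝ => Complex.exp (-μ * s) • y s)
    (fun s hs => ((hf s hs.1).continuousWithinAt).mono Icc_subset_Ici_self)
    (fun s hs => (hf s hs.1).mono (Ici_subset_Ici.2 hs.1))
    (B := fun s : ℝ => ‖x 0‖ + K / d * (Real.exp (d * s) - 1)) (by simp) hB
    (fun s hs => by
      rw [norm_smul, hnexp]
      calc _ ≤ Real.exp (-μ.re * s) * (K * Real.exp (-lam * s)) := by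
            gcongr; exact hy s hs.1
        _ = K * Real.exp (d * s) := by
            rw [mul_left_comm, ← Real.exp_add, hd]; ring_nf) (right_mem_Icc.2 ht)
  rw [norm_smul, hnexp] at key
  have e1 : Real.exp (μ.re * t) * Real.exp (-μ.re * t) = 1 := by
    rw [← Real.exp_add]; simp
  have e2 : Real.exp (μ.re * t) * Real.exp (d * t) = Real.exp (-lam * t) := by
    rw [← Real.exp_add, hd]; ring_nf
  have e3 : Real.exp (μ.re * t) ≤ Real.exp (-lam * t) := by
    apply Real.exp_le_exp.2; nlinarith
  have hKd : 0 ≤ K / d := by positivity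
  calc ‖x t‖ = Real.exp (μ.re * t) * (Real.exp (-μ.re * t) * ‖x t‖) := by
        rw [← mul_assoc, e1, one_mul]
    _ ≤ Real.exp (μ.re * t) * (‖x 0‖ + K / d * (Real.exp (d * t) - 1)) := by gcongr
    _ = ‖x 0‖ * Real.exp (μ.re * t) + K / d * (Real.exp (-lam * t)) - K / d * Real.exp (μ.re * t) := by
        rw [← e2]; ring
    _ ≤ ‖x 0‖ * Real.exp (-lam * t) + K / d * (Real.exp (-lam * t)) - 0 := by
        gcongr; positivity
    _ = _ := by ring

open Set Polynomial in
theorem aux_list {E : Type*} [NormedAddCommGroup E] [NormedSpace ℂ E] [FiniteDimensional ℂ E]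
    (A : Module.End ℂ E) (lam : ℝ) (l : List ℂ) :
    (∀ μ ∈ l, μ.re < -lam) → ∃ K : ℝ, 0 ≤ K ∧ ∀ x : ℝ → E,
      (∀ t, 0 ≤ t → HasDerivWithinAt x (A (x t)) (Ici 0) t) →
      (∀ t, 0 ≤ t → aeval A (l.map (fun μ => X - C μ)).prod (x t) = 0) →
      ∀ t, 0 ≤ t → ‖x t‖ ≤ K * ‖x 0‖ * Real.exp (-lam * t) := by
  induction l with
  | nil =>
    intro _
    refine ⟨0, le_rfl, fun x _ h t ht => ?_⟩
    have := h t ht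
    simp at this
    simp [this]
  | cons μ l ih =>
    intro hl
    obtain ⟨K, hK, h⟩ := ih (fun ν hν => hl ν (List.mem_cons_of_mem _ hν))
    let B : Module.End ℂ E := A - algebraMap ℂ _ μ
    let Bc : E →L[ℂ] E := LinearMap.toContinuousLinearMap B
    have hBc : ∀ v, Bc v = A v - μ • v := by intro v; simp [Bc, B]
    have hμ := hl μ List.mem_cons_self
    have hd : 0 < -lam - μ.re := by linarith
    refine ⟨1 + K * ‖Bc‖ / (-lam - μ.re), by positivity, fun x hx hp t ht => ?_⟩
    have hy := h (fun t => Bc (x t)) (by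
      intro t ht
      have := ((Bc.restrictScalars ℝ).hasFDerivAt (x := x t)).comp_hasDerivWithinAt t (hx t ht)
      refine this.congr_deriv ?_
      change Bc (A (x t)) = A (Bc (x t))
      simp [hBc]) (by
      intro t ht
      have := hp t ht
      rw [List.map_cons, List.prod_cons, mul_comm, map_mul] at this
      simpa [hBc] using this)
    have := aux_step μ lam (K * ‖Bc‖ * ‖x 0‖) hμ (by positivity) x (fun t => Bc (x t))
      (fun t ht => by
        convert hx t ht using 1
        simp [hBc]) (fun t ht => by
          refine (hy t ht).trans ?_
          rw [mul_assoc K ‖Bc‖]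
          exact mul_le_mul_of_nonneg_right
            (mul_le_mul_of_nonneg_left (Bc.le_opNorm _) hK) (Real.exp_pos _).le) t ht
    refine this.trans (le_of_eq ?_)
    ring

open Set Polynomial in
theorem aux_hurwitz {E : Type*} [NormedAddCommGroup E] [NormedSpace ℂ E] [FiniteDimensional ℂ E]
    (A : Module.End ℂ E) (hA : ∀ μ, A.HasEigenvalue μ → μ.re < 0) :
    ∃ lam > 0, ∃ K : ℝ, 0 ≤ K ∧ ∀ x : ℝ → E,
      (∀ t, 0 ≤ t → HasDerivWithinAt x (A (x t)) (Ici 0) t) →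
      ∀ t, 0 ≤ t → ‖x t‖ ≤ K * ‖x 0‖ * Real.exp (-lam * t) := by
  have hint : IsIntegral ℂ A := Algebra.IsIntegral.isIntegral A
  have hmon := minpoly.monic hint
  have hprod := (IsAlgClosed.splits (minpoly ℂ A)).eq_prod_roots_of_monic hmon
  have hroots : ∀ μ ∈ (minpoly ℂ A).roots.toList, μ.re < 0 := by
    intro μ hμ
    rw [Multiset.mem_toList, mem_roots hmon.ne_zero] at hμ
    exact hA μ (Module.End.hasEigenvalue_of_isRoot hμ)
  generalize hl : (minpoly ℂ A).roots.toList = l at hroots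
  have hlam : ∃ lam > 0, ∀ μ ∈ l, μ.re < -lam := by
    clear hl
    induction l with
    | nil => exact ⟨1, one_pos, by simp⟩
    | cons ν l ih =>
      obtain ⟨a, ha, h⟩ := ih (fun μ hμ => hroots μ (List.mem_cons_of_mem _ hμ))
      have hν := hroots ν List.mem_cons_self
      refine ⟨min a (-ν.re / 2), lt_min ha (by linarith), ?_⟩
      intro μ hμ
      rcases List.mem_cons.1 hμ with rfl | hμ
      · have := min_le_right a (-μ.re / 2); linarith
      · have := min_le_left a (-ν.re / 2); have := h μ hμ; linarith
  obtain ⟨lam, hpos, h⟩ := hlam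
  obtain ⟨K, hK, hKx⟩ := aux_list A lam l h
  refine ⟨lam, hpos, K, hK, fun x hx => hKx x hx fun t ht => ?_⟩
  have : (l.map (fun μ => X - C μ)).prod = minpoly ℂ A := by
    rw [hprod, ← hl]
    conv_rhs => rw [← Multiset.coe_toList (minpoly ℂ A).roots]
    rw [Multiset.map_coe, Multiset.prod_coe]
  rw [this, minpoly.aeval]
  simp

abbrev CV3 := Fin 3 → ℂ

/-- companion operator -/
def compOp (KP KD KI : Mat3) : Module.End ℂ (CV3 × CV3 × CV3) :=
  LinearMap.prod (LinearMap.fst ℂ CV3 CV3 ∘ₗ LinearMap.snd ℂ CV3 (CV3 × CV3))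
    (LinearMap.prod (LinearMap.snd ℂ CV3 CV3 ∘ₗ LinearMap.snd ℂ CV3 (CV3 × CV3))
      (-((Matrix.mulVecLin (KI.map (algebraMap ℝ ℂ))) ∘ₗ LinearMap.fst ℂ CV3 (CV3 × CV3))
        - (Matrix.mulVecLin (KP.map (algebraMap ℝ ℂ))) ∘ₗ (LinearMap.fst ℂ CV3 CV3 ∘ₗ LinearMap.snd ℂ CV3 (CV3 × CV3))
        - (Matrix.mulVecLin (KD.map (algebraMap ℝ ℂ))) ∘ₗ (LinearMap.snd ℂ CV3 CV3 ∘ₗ LinearMap.snd ℂ CV3 (CV3 × CV3))))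

theorem compOp_apply (KP KD KI : Mat3) (a b c : CV3) :
    compOp KP KD KI (a, b, c) = (b, c, -((KI.map (algebraMap ℝ ℂ)) *ᵥ a)
      - (KP.map (algebraMap ℝ ℂ)) *ᵥ b - (KD.map (algebraMap ℝ ℂ)) *ᵥ c) := rfl

open Polynomial in
theorem compOp_eig (KP KD KI : Mat3)
    (hHur : IsHurwitzPoly
      (((X ^ 3 : ℝ[X]) • (1 : Matrix (Fin 3) (Fin 3) ℝ[X]) + (X ^ 2 : ℝ[X]) • KD.map C
        + (X : ℝ[X]) • KP.map C + KI.map C).det)) (μ : ℂ)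
    (h : (compOp KP KD KI).HasEigenvalue μ) : μ.re < 0 := by
  obtain ⟨⟨a, b, c⟩, hv⟩ := h.exists_hasEigenvector
  have h1 := hv.apply_eq_smul
  have h0 := hv.2
  rw [compOp_apply] at h1
  simp only [Prod.smul_mk, Prod.mk.injEq] at h1
  obtain ⟨rfl, rfl, h3⟩ := h1
  have ha : a ≠ 0 := by
    rintro rfl
    simp at h0
  apply hHur
  rw [Polynomial.eval_map, ← Polynomial.coe_eval₂RingHom, RingHom.map_det]
  have : (Polynomial.eval₂RingHom (algebraMap ℝ ℂ) μ).mapMatrix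
      ((X ^ 3 : ℝ[X]) • (1 : Matrix (Fin 3) (Fin 3) ℝ[X]) + (X ^ 2 : ℝ[X]) • KD.map C
        + (X : ℝ[X]) • KP.map C + KI.map C) =
      (μ ^ 3) • (1 : Matrix (Fin 3) (Fin 3) ℂ) + (μ ^ 2) • KD.map (algebraMap ℝ ℂ)
        + μ • KP.map (algebraMap ℝ ℂ) + KI.map (algebraMap ℝ ℂ) := by
    ext i j
    by_cases hij : i = j
    · subst hij; simp; ring
    · simp [Matrix.one_apply_ne hij]; ring
  rw [this, ← Matrix.exists_mulVec_eq_zero_iff]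
  refine ⟨a, ha, ?_⟩
  simp only [Matrix.mulVec_smul] at h3
  simp only [Matrix.add_mulVec, Matrix.smul_mulVec, Matrix.one_mulVec]
  have h4 : (μ ^ 3) • a = μ • μ • μ • a := by simp only [smul_smul]; ring_nf
  rw [h4, ← h3, pow_two, mul_smul]
  abel

theorem enorm3_nonneg (v : Fin 3 → ℝ) : 0 ≤ enorm3 v := Real.sqrt_nonneg _

theorem norm_le_enorm3 (v : Fin 3 → ℝ) : ‖v‖ ≤ enorm3 v := by
  rw [pi_norm_le_iff_of_nonneg (enorm3_nonneg v)]
  intro i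
  rw [Real.norm_eq_abs]
  apply Real.abs_le_sqrt
  exact Finset.single_le_sum (f := fun i => v i ^ 2) (fun i _ => sq_nonneg _) (Finset.mem_univ i)

theorem enorm3_le (v : Fin 3 → ℝ) : enorm3 v ≤ 2 * ‖v‖ := by
  apply Real.sqrt_le_iff.2 ⟨by positivity, ?_⟩
  have h : ∀ i, v i ^ 2 ≤ ‖v‖ ^ 2 := fun i => by
    rw [← sq_abs]
    gcongr
    exact norm_le_pi_norm v i
  rw [Fin.sum_univ_three]
  nlinarith [h 0, h 1, h 2, sq_nonneg ‖v‖]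

theorem norm_cross_le (u v : Fin 3 → ℝ) : ‖cross u v‖ ≤ 2 * ‖u‖ * ‖v‖ := by
  have hm : ∀ i j k l, |u i * v j - u k * v l| ≤ 2 * ‖u‖ * ‖v‖ := by
    intro i j k l
    have h1 : |u i * v j| ≤ ‖u‖ * ‖v‖ := by
      rw [abs_mul]; gcongr; exacts [norm_le_pi_norm u i, norm_le_pi_norm v j]
    have h2 : |u k * v l| ≤ ‖u‖ * ‖v‖ := by
      rw [abs_mul]; gcongr; exacts [norm_le_pi_norm u k, norm_le_pi_norm v l]
    have := abs_sub (u i * v j) (u k * v l)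
    linarith
  rw [pi_norm_le_iff_of_nonneg (by positivity)]
  intro i
  rw [Real.norm_eq_abs]
  fin_cases i <;> exact hm _ _ _ _

theorem hasDerivAt_cross {a b : ℝ → Fin 3 → ℝ} {a' b' : Fin 3 → ℝ} {t : ℝ}
    (ha : HasDerivAt a a' t) (hb : HasDerivAt b b' t) :
    HasDerivAt (fun t => cross (a t) (b t)) (cross a' (b t) + cross (a t) b') t := by
  rw [hasDerivAt_pi] at ha hb ⊢
  intro i
  fin_cases i
  · refine (((ha 1).mul (hb 2)).sub ((ha 2).mul (hb 1))).congr_deriv ?_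
    simp [cross]; ring
  · refine (((ha 2).mul (hb 0)).sub ((ha 0).mul (hb 2))).congr_deriv ?_
    simp [cross]; ring
  · refine (((ha 0).mul (hb 1)).sub ((ha 1).mul (hb 0))).congr_deriv ?_
    simp [cross]; ring

/-- complexification of a real vector -/
def cplx (v : Fin 3 → ℝ) : CV3 := fun i => (v i : ℂ)

theorem norm_cplx (v : Fin 3 → ℝ) : ‖cplx v‖ = ‖v‖ := by
  simp [cplx, Pi.norm_def]

theorem cplx_mulVec (M : Mat3) (v : Fin 3 → ℝ) :
    cplx (M *ᵥ v) = (M.map (algebraMap ℝ ℂ)) *ᵥ (cplx v) := by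
  ext i
  simp [cplx, Matrix.mulVec, dotProduct]

theorem hasDerivWithinAt_cplx {a : ℝ → Fin 3 → ℝ} {a' : Fin 3 → ℝ} {t : ℝ} {s : Set ℝ}
    (ha : HasDerivWithinAt a a' s t) : HasDerivWithinAt (fun t => cplx (a t)) (cplx a') s t := by
  rw [hasDerivWithinAt_pi] at ha ⊢
  intro i
  exact (ha i).ofReal_comp

theorem hasDeriv_int (z z' : ℝ → Fin 3 → ℝ) (hz : ∀ t, 0 ≤ t → HasDerivAt z (z' t) t) (t : ℝ)
    (ht : 0 ≤ t) :
    HasDerivWithinAt (fun t => ∫ τ in (0:ℝ)..t, z τ) (z t) (Set.Ici 0) t := by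
  have hc : Continuous (fun t => z (max t 0)) := by
    rw [continuous_iff_continuousAt]
    intro s
    exact ContinuousAt.comp (f := fun t : ℝ => max t 0) (g := z)
      (hz _ (le_max_right _ _)).continuousAt (by fun_prop)
  have h1 := (hc.integral_hasStrictDerivAt 0 t).hasDerivAt.hasDerivWithinAt (s := Set.Ici 0)
  simp only [max_eq_left ht] at h1
  have he : ∀ u ∈ Set.Ici (0:ℝ), ∫ τ in (0:ℝ)..u, z τ = ∫ τ in (0:ℝ)..u, z (max τ 0) := by
    intro u hu
    apply intervalIntegral.integral_congr
    intro s hs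
    rw [Set.uIcc_of_le hu] at hs
    simp only [max_eq_left hs.1]
  exact h1.congr he (he t ht)

theorem frob_sq (M : Mat3) : ‖M‖ ^ 2 = ∑ i, ∑ j, M i j ^ 2 := by
  rw [Matrix.frobenius_norm_def, ← Real.rpow_natCast, ← Real.rpow_mul (by positivity)]
  simp

theorem Zs_bound (ke : ℝ) (Ω₀ : ℝ → Fin 3 → ℝ) (Zs : ℝ → Mat3)
    (hs : ∀ t, 0 ≤ t → (Zs t)ᵀ = Zs t)
    (hd : ∀ t, 0 ≤ t →
          HasDerivAt Zs (mcomm (Zs t) (hat (Ω₀ t)) - (2 * ke) • Zs t) t) (t : ℝ) (ht : 0 ≤ t) :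
    ‖Zs t‖ = Real.exp (-(2 * ke) * t) * ‖Zs 0‖ := by
  have hent : ∀ t, 0 ≤ t → ∀ i j, HasDerivAt (fun t => Zs t i j)
      ((mcomm (Zs t) (hat (Ω₀ t)) - (2 * ke) • Zs t) i j) t := by
    intro t ht i j
    let L : Mat3 →ₗ[ℝ] ℝ := Matrix.entryLinearMap ℝ ℝ i j
    exact (LinearMap.toContinuousLinearMap L).hasFDerivAt.comp_hasDerivAt t (hd t ht)
  have hexp : ∀ s, HasDerivAt (fun s : ℝ => Real.exp (4 * ke * s)) (Real.exp (4 * ke * s) * (4 * ke)) s := by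
    intro s
    have h1 : HasDerivAt (fun s : ℝ => 4 * ke * s) (4 * ke) s := by
      simpa using (hasDerivAt_id s).const_mul (4 * ke)
    exact h1.exp
  have hder : ∀ t, 0 ≤ t → HasDerivAt (fun t => Real.exp (4 * ke * t) * ∑ i, ∑ j, Zs t i j ^ 2) 0 t := by
    intro t ht
    have h2 := HasDerivAt.fun_sum (u := Finset.univ) fun i _ => HasDerivAt.fun_sum (u := Finset.univ)
      fun j _ => (hent t ht i j).fun_pow 2
    refine ((hexp t).mul h2).congr_deriv ?_
    have hsym : ∀ i j, Zs t j i = Zs t i j := fun i j => by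
      conv_rhs => rw [← hs t ht]
      rfl
    have h10 := hsym 0 1
    have h20 := hsym 0 2
    have h21 := hsym 1 2
    simp only [Fin.sum_univ_three, mcomm, Matrix.sub_apply, Matrix.smul_apply, Matrix.mul_apply, hat,
      Matrix.of_apply, Matrix.cons_val, h10, h20, h21, smul_eq_mul]
    norm_num
    ring
  have hconst := constant_of_has_deriv_right_zero (a := 0) (b := t)
    (f := fun t => Real.exp (4 * ke * t) * ∑ i, ∑ j, Zs t i j ^ 2)
    (fun s hs => (hder s hs.1).continuousAt.continuousWithinAt)
    (fun s hs => (hder s hs.1).hasDerivWithinAt) t (Set.right_mem_Icc.2 ht)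
  simp only [← frob_sq] at hconst
  rw [← sq_eq_sq₀ (by positivity) (by positivity), mul_pow]
  have e : Real.exp (-(2 * ke) * t) ^ 2 * Real.exp (4 * ke * t) = 1 := by
    rw [← Real.exp_nat_mul, ← Real.exp_add]
    norm_num; ring
  simp only [mul_zero, Real.exp_zero, one_mul] at hconst
  rw [← hconst, ← mul_assoc, e, one_mul]

open Polynomial in
/-- Proposition 2: the PID-like feedback with integral term exponentially
stabilizes the origin of the linearized rigid body tracking error dynamics,
provided `det(λ³I + λ²K_D + λK_P + K_I)` is a Hurwitz polynomial. -/
theorem prop2_PID_exp_stabilization (ke : ℝ) (hke : 0 < ke)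
    (Ω₀ u₀ : ℝ → Fin 3 → ℝ)
    (hΩ₀diff : ∀ t, 0 ≤ t → HasDerivAt Ω₀ (u₀ t) t)
    (hΩ₀bdd : ∃ M, ∀ t, 0 ≤ t → enorm3 (Ω₀ t) ≤ M)
    (hu₀bdd : ∃ M, ∀ t, 0 ≤ t → enorm3 (u₀ t) ≤ M)
    (KP KD KI : Mat3)
    (hHur : IsHurwitzPoly
      (((X ^ 3 : ℝ[X]) • (1 : Matrix (Fin 3) (Fin 3) ℝ[X]) + (X ^ 2 : ℝ[X]) • KD.map C
        + (X : ℝ[X]) • KP.map C + KI.map C).det)) :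
    ∃ Cst > (0:ℝ), ∃ lam > (0:ℝ),
      ∀ (Zs : ℝ → Mat3) (z ω : ℝ → Fin 3 → ℝ),
        (∀ t, 0 ≤ t → (Zs t)ᵀ = Zs t) →
        (∀ t, 0 ≤ t →
          HasDerivAt Zs (mcomm (Zs t) (hat (Ω₀ t)) - (2 * ke) • Zs t) t) →
        (∀ t, 0 ≤ t → HasDerivAt z (cross (z t) (Ω₀ t) + ω t) t) →
        (∀ t, 0 ≤ t → HasDerivAt ω
          (-(KP.mulVec (z t)) - KD.mulVec (cross (z t) (Ω₀ t) + ω t)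
            - KI.mulVec (∫ τ in (0:ℝ)..t, z τ)
            - cross (cross (z t) (Ω₀ t) + ω t) (Ω₀ t) - cross (z t) (u₀ t)) t) →
        ∀ t, 0 ≤ t →
          ‖Zs t‖ + enorm3 (z t) + enorm3 (ω t) ≤
            Cst * Real.exp (-lam * t) * (‖Zs 0‖ + enorm3 (z 0) + enorm3 (ω 0)) := by
  obtain ⟨lam, hlam, K, hK, hdecay⟩ := aux_hurwitz (compOp KP KD KI) (compOp_eig KP KD KI hHur)
  obtain ⟨M, hM⟩ := hΩ₀bdd
  have hM0 : 0 ≤ M := (enorm3_nonneg _).trans (hM 0 le_rfl)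
  have hΩ : ∀ t, 0 ≤ t → ‖Ω₀ t‖ ≤ M := fun t ht => (norm_le_enorm3 _).trans (hM t ht)
  refine ⟨1 + (4 + 4 * M) * K * (1 + 2 * M), by positivity, min lam (2 * ke),
    lt_min hlam (by linarith), ?_⟩
  intro Zs z ω hsym hZs hz hω t ht
  have hw : ∀ t, 0 ≤ t → HasDerivAt (fun t => cross (z t) (Ω₀ t) + ω t)
      (-(KI *ᵥ (∫ τ in (0:ℝ)..t, z τ)) - KP *ᵥ (z t) - KD *ᵥ (cross (z t) (Ω₀ t) + ω t)) t := by
    intro t ht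
    refine ((hasDerivAt_cross (hz t ht) (hΩ₀diff t ht)).add (hω t ht)).congr_deriv ?_
    abel
  set w : ℝ → Fin 3 → ℝ := fun t => cross (z t) (Ω₀ t) + ω t with hwdef
  have hx := hdecay (fun t => (cplx (∫ τ in (0:ℝ)..t, z τ), cplx (z t), cplx (w t))) (by
    intro t ht
    rw [compOp_apply, ← cplx_mulVec, ← cplx_mulVec, ← cplx_mulVec]
    have e : -cplx (KI *ᵥ (∫ τ in (0:ℝ)..t, z τ)) - cplx (KP *ᵥ (z t)) - cplx (KD *ᵥ (w t)) =
        cplx (-(KI *ᵥ (∫ τ in (0:ℝ)..t, z τ)) - KP *ᵥ (z t) - KD *ᵥ (w t)) := by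
      ext i; simp [cplx]
    rw [e]
    exact (hasDerivWithinAt_cplx (hasDeriv_int z _ hz t ht)).prodMk
      ((hasDerivWithinAt_cplx (hz t ht).hasDerivWithinAt).prodMk
        (hasDerivWithinAt_cplx (hw t ht).hasDerivWithinAt))) t ht
  have hc0 : cplx 0 = 0 := by ext i; simp [cplx]
  simp only [Prod.norm_mk, norm_cplx, intervalIntegral.integral_same, norm_zero] at hx
  set N := ‖Zs 0‖ + enorm3 (z 0) + enorm3 (ω 0) with hN
  have n1 := enorm3_nonneg (z 0)
  have n2 := enorm3_nonneg (ω 0)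
  have n3 := norm_nonneg (Zs 0)
  have m1 := norm_le_enorm3 (z 0)
  have m2 := norm_le_enorm3 (ω 0)
  have hw0 : ‖w 0‖ ≤ (1 + 2 * M) * (enorm3 (z 0) + enorm3 (ω 0)) := by
    have h1 := norm_add_le (cross (z 0) (Ω₀ 0)) (ω 0)
    have h2 := norm_cross_le (z 0) (Ω₀ 0)
    have h3 : 2 * ‖z 0‖ * ‖Ω₀ 0‖ ≤ 2 * enorm3 (z 0) * M := by
      gcongr; exact hΩ 0 le_rfl
    have h4 : 0 ≤ M * enorm3 (ω 0) := by positivity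
    calc ‖w 0‖ ≤ _ := h1
      _ ≤ _ := by nlinarith
  have hmax : max 0 (max ‖z 0‖ ‖w 0‖) ≤ (1 + 2 * M) * (enorm3 (z 0) + enorm3 (ω 0)) := by
    refine max_le (by positivity) (max_le ?_ hw0)
    nlinarith [mul_nonneg hM0 n1, mul_nonneg hM0 n2]
  set S := K * ((1 + 2 * M) * (enorm3 (z 0) + enorm3 (ω 0))) * Real.exp (-lam * t) with hS
  have hx' : max ‖∫ τ in (0:ℝ)..t, z τ‖ (max ‖z t‖ ‖w t‖) ≤ S := hx.trans (by
    rw [hS]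
    exact mul_le_mul_of_nonneg_right (mul_le_mul_of_nonneg_left
      (by simpa [hc0] using hmax) hK) (Real.exp_pos _).le)
  have hzt : ‖z t‖ ≤ S := ((le_max_left _ _).trans (le_max_right _ _)).trans hx'
  have hwt : ‖w t‖ ≤ S := ((le_max_right _ _).trans (le_max_right _ _)).trans hx'
  have hωt : ‖ω t‖ ≤ S + 2 * S * M := by
    have e : ω t = w t - cross (z t) (Ω₀ t) := by simp [hwdef]
    rw [e]
    have h1 := norm_sub_le (w t) (cross (z t) (Ω₀ t))
    have h2 := norm_cross_le (z t) (Ω₀ t)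
    have h3 : 2 * ‖z t‖ * ‖Ω₀ t‖ ≤ 2 * S * M := by
      have hS0 := (norm_nonneg _).trans hzt
      gcongr
      exact hΩ t ht
    linarith
  have a1 := enorm3_le (z t)
  have a2 := enorm3_le (ω t)
  have hZ := Zs_bound ke Ω₀ Zs hsym hZs t ht
  set e := Real.exp (-(min lam (2 * ke)) * t) with he
  have e0 : 0 < e := Real.exp_pos _
  have e1 : Real.exp (-lam * t) ≤ e := by
    apply Real.exp_le_exp.2; gcongr; exact min_le_left _ _
  have e2 : Real.exp (-(2 * ke) * t) ≤ e := by
    apply Real.exp_le_exp.2; gcongr; exact min_le_right _ _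
  have b1 : ‖Zs t‖ ≤ e * N := by
    rw [hZ]; gcongr; linarith
  have b2 : S ≤ K * ((1 + 2 * M) * N) * e := by
    rw [hS]; gcongr; linarith
  calc _ ≤ e * N + (4 + 4 * M) * S := by linarith
    _ ≤ e * N + (4 + 4 * M) * (K * ((1 + 2 * M) * N) * e) := by gcongr
    _ = _ := by ring

end
end

section
/- Let R₀ : [0,∞) → ℝ^{3×3} and Ω₀ : [0,∞) → ℝ³ be differentiable and bounded with R₀(t) ∈ SO(3), Ṙ₀(t) = R₀(t)·Ω̂₀(t) for all t ≥ 0, and with u₀ := Ω̇₀ bounded. Fix k_R > 0 and k_Ω > 0 and consider the closed-loop rigid body system Ṙ = R·Ω̂, Ω̇ = u₀(t) − k_R·Skew(R₀(t)ᵀ R)^∨ − k_Ω·(Ω − Ω₀(t)) + (Ω − Ω₀(t)) × Ω₀(t). Then there exist δ > 0, C > 0 and λ > 0 such that every solution (R, Ω) : [0,∞) → ℝ^{3×3} × ℝ³ with R(0) ∈ SO(3) and ‖R(0) − R₀(0)‖ + ‖Ω(0) − Ω₀(0)‖ < δ satisfies ‖R(t) − R₀(t)‖ + ‖Ω(t)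 − Ω₀(t)‖ ≤ C·e^{−λt}·(‖R(0) − R₀(0)‖ + ‖Ω(0) − Ω₀(0)‖) for all t ≥ 0; i.e., the controller makes the fully actuated rigid body system track the reference trajectory (R₀, Ω₀) exponentially. -/
open Matrix

attribute [local instance] Matrix.frobeniusNormedAddCommGroup Matrix.frobeniusNormedSpace

noncomputable section

theorem decay (p a q qd s2 : ℝ → ℝ) (kR k : ℝ) (hkR : 0 < kR) (hk : 0 < k) (ε c : ℝ) (hε : 0 < ε)
    (h1 : ε ≤ 1/2) (h2 : ε ≤ kR/2) (h3 : ε * (3 + k^2/(2*kR)) ≤ k/2)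
    (hc : 0 < c) (hc1 : c ≤ k) (hc2 : c ≤ ε/2)
    (hp : ∀ t, 0 ≤ t → HasDerivAt p (2 * q t) t)
    (ha : ∀ t, 0 ≤ t → HasDerivAt a (-2 * kR * q t - 2 * k * a t) t)
    (hq : ∀ t, 0 ≤ t → HasDerivAt q (qd t) t)
    (hqd : ∀ t, 0 ≤ t → qd t ≤ 3 * a t - kR * s2 t - k * q t)
    (hs : ∀ t, 0 ≤ t → s2 t = p t - p t ^ 2 / 4)
    (hp0 : ∀ t, 0 ≤ t → 0 ≤ p t) (ha0 : ∀ t, 0 ≤ t → 0 ≤ a t)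
    (hqs : ∀ t, 0 ≤ t → q t ^ 2 ≤ s2 t * a t)
    (hinit : a 0 + kR * p 0 ≤ 2 * kR) (t : ℝ) (ht : 0 ≤ t) :
    a t + kR * p t ≤ 3 * Real.exp (-(2*c/3) * t) * (a 0 + kR * p 0) := by
  have hV : AntitoneOn (fun t => a t + kR * p t) (Set.Ici 0) := by
    have hd : ∀ t, 0 ≤ t → HasDerivAt (fun t => a t + kR * p t)
      ((-2 * kR * q t - 2 * k * a t) + kR * (2 * q t)) t := fun t ht =>
        (ha t ht).add ((hp t ht).const_mul kR)
    apply antitoneOn_of_deriv_nonpos (convex_Ici 0)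
    · exact fun t ht => (hd t ht).continuousAt.continuousWithinAt
    · intro t ht
      rw [interior_Ici] at ht
      exact (hd t (le_of_lt ht)).differentiableAt.differentiableWithinAt
    · intro t ht
      rw [interior_Ici] at ht
      rw [(hd t (le_of_lt ht)).deriv]
      have := mul_nonneg hk.le (ha0 t (le_of_lt ht))
      linarith
  have hp2 : ∀ t, 0 ≤ t → p t ≤ 2 := by
    intro t ht
    have h := hV (Set.mem_Ici.2 le_rfl) (Set.mem_Ici.2 ht) ht
    simp only at h
    have := ha0 t ht
    by_contra hh
    push Not at hh
    nlinarith
  have hqabs : ∀ t, 0 ≤ t → |ε * q t| ≤ (a t + kR * p t) / 4 := by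
    intro t ht
    have hP := hp0 t ht
    have hA := ha0 t ht
    have h4 : |q t| ≤ (p t + a t)/2 := by
      apply abs_le_of_sq_le_sq _ (by linarith)
      have := hqs t ht
      rw [hs t ht] at this
      nlinarith [sq_nonneg (p t - a t), mul_nonneg (sq_nonneg (p t)) hA]
    rw [abs_mul, abs_of_pos hε]
    calc ε * |q t| ≤ ε * ((p t + a t)/2) := by gcongr
      _ ≤ _ := by nlinarith
  have hW : AntitoneOn (fun t => Real.exp ((2*c/3) * t) * ((a t + kR * p t)/2 + ε * q t)) (Set.Ici 0) := by
    have hd : ∀ t, 0 ≤ t → HasDerivAt (fun t => Real.exp ((2*c/3) * t) * ((a t + kR * p t)/2 + ε * q t))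
      ((Real.exp ((2*c/3) * t) * ((2*c/3) * 1)) * ((a t + kR * p t)/2 + ε * q t) +
        Real.exp ((2*c/3) * t) * (((-2 * kR * q t - 2 * k * a t) + kR * (2 * q t))/2 + ε * qd t)) t := fun t ht =>
        (((hasDerivAt_id t).const_mul (2*c/3)).exp).mul
          ((((ha t ht).add ((hp t ht).const_mul kR)).div_const 2).add ((hq t ht).const_mul ε))
    apply antitoneOn_of_deriv_nonpos (convex_Ici 0)
    · exact fun t ht => (hd t ht).continuousAt.continuousWithinAt
    · intro t ht
      rw [interior_Ici] at ht
      exact (hd t (le_of_lt ht)).differentiableAt.differentiableWithinAt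
    · intro t ht
      rw [interior_Ici] at ht
      have ht : 0 ≤ t := le_of_lt ht
      rw [(hd t ht).deriv]
      have hP := hp0 t ht
      have hA := ha0 t ht
      have e := Real.exp_pos ((2*c/3) * t)
      have hb := (abs_le.1 (hqabs t ht)).2
      have hs2 : p t / 2 ≤ s2 t := by rw [hs t ht]; nlinarith [hp2 t ht]
      have hyoung : -(k * q t) ≤ kR/2 * s2 t + k^2/(2*kR) * a t := by
        have hS : 0 ≤ s2 t := by linarith
        have : |k * q t| ≤ kR/2 * s2 t + k^2/(2*kR) * a t := by
          apply abs_le_of_sq_le_sq _ (by positivity)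
          have e1 : (kR/2 * s2 t + k^2/(2*kR) * a t)^2 = (kR/2 * s2 t - k^2/(2*kR) * a t)^2 + k^2 * (s2 t * a t) := by
            field_simp; ring
          rw [e1, mul_pow]
          nlinarith [hqs t ht, sq_nonneg (kR/2 * s2 t - k^2/(2*kR) * a t), mul_le_mul_of_nonneg_left (hqs t ht) (sq_nonneg k)]
        linarith [neg_abs_le (k * q t)]
      have key : ε * qd t ≤ k/2 * a t - ε * kR / 4 * p t := by
        have i1 : qd t ≤ (3 + k^2/(2*kR)) * a t - kR/4 * p t := by
          have := hqd t ht
          nlinarith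
        have i2 := mul_le_mul_of_nonneg_left i1 hε.le
        have i3 := mul_le_mul_of_nonneg_right h3 hA
        linarith
      have hfin : (2*c/3) * ((a t + kR * p t)/2 + ε * q t) + (((-2 * kR * q t - 2 * k * a t) + kR * (2 * q t))/2 + ε * qd t) ≤ 0 := by
        have j1 : (2*c/3) * ((a t + kR * p t)/2 + ε * q t) ≤ (2*c/3) * ((a t + kR * p t)*(3/4)) := by
          gcongr; linarith
        have j2 := mul_le_mul_of_nonneg_right hc1 hA
        have j3 := mul_le_mul_of_nonneg_right hc2 (mul_nonneg hkR.le hP)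
        linarith
      nlinarith
  have h := hW (Set.mem_Ici.2 le_rfl) (Set.mem_Ici.2 ht) ht
  simp only [mul_zero, Real.exp_zero, one_mul] at h
  have b1 := (abs_le.1 (hqabs t ht)).1
  have b0 := (abs_le.1 (hqabs 0 le_rfl)).2
  have e := Real.exp_pos ((2*c/3) * t)
  have h' : Real.exp ((2*c/3) * t) * ((a t + kR * p t)/4) ≤ (a 0 + kR * p 0)*(3/4) := by
    refine le_trans ?_ (h.trans (by linarith))
    gcongr; linarith
  rw [neg_mul, Real.exp_neg]
  have : a t + kR * p t = (Real.exp ((2*c/3) * t))⁻¹ * (Real.exp ((2*c/3) * t) * (a t + kR * p t)) := by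
    field_simp
  rw [this, mul_comm 3, mul_assoc]
  exact mul_le_mul_of_nonneg_left (by linarith) (by positivity)

theorem mat_entry {R : ℝ → Mat3} {R' : Mat3} {t : ℝ} (h : HasDerivAt R R' t) (i j : Fin 3) :
    HasDerivAt (fun t => R t i j) (R' i j) t := by
  let L : Mat3 →ₗ[ℝ] ℝ := Matrix.entryLinearMap ℝ ℝ i j
  have := (LinearMap.toContinuousLinearMap L).hasFDerivAt.comp_hasDerivAt t h
  exact this

theorem prod_entry {A B : ℝ → Mat3} {A' B' : Mat3} {t : ℝ}
    (hA : ∀ i j, HasDerivAt (fun t => A t i j) (A' i j) t)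
    (hB : ∀ i j, HasDerivAt (fun t => B t i j) (B' i j) t) (i j : Fin 3) :
    HasDerivAt (fun t => (A t * B t) i j) ((A' * B t + A t * B') i j) t := by
  have h := HasDerivAt.fun_sum (u := Finset.univ) (fun k _ => (hA i k).mul (hB k j))
  rw [Matrix.add_apply, Matrix.mul_apply, Matrix.mul_apply, ← Finset.sum_add_distrib]
  simp only [Matrix.mul_apply]
  exact h

theorem const_of_deriv {f : ℝ → ℝ} (h : ∀ t, 0 ≤ t → HasDerivAt f 0 t) (t : ℝ) (ht : 0 ≤ t) :
    f t = f 0 := by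
  refine constant_of_has_deriv_right_zero (a := 0) (b := t) (f := f) ?_ ?_ t ⟨ht, le_rfl⟩
  · exact fun x hx => (h x hx.1).continuousAt.continuousWithinAt
  · exact fun x hx => (h x hx.1).hasDerivWithinAt

theorem hat_transpose (v : Fin 3 → ℝ) : (hat v)ᵀ = - hat v := by
  ext i j
  fin_cases i <;> fin_cases j <;> simp [hat]

theorem det_one {E : Mat3} (h : Eᵀ * E = 1) (hd : 0 < E.det) : E.det = 1 := by
  have := congrArg Matrix.det h
  rw [Matrix.det_mul, Matrix.det_transpose, Matrix.det_one] at this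
  nlinarith

theorem stays (R : ℝ → Mat3) (Ω : ℝ → Fin 3 → ℝ) (h0 : R 0 ∈ SO3)
    (hR : ∀ t, 0 ≤ t → HasDerivAt R (R t * hat (Ω t)) t) (t : ℝ) (ht : 0 ≤ t) :
    (R t)ᵀ * R t = 1 ∧ (R t).det = 1 := by
  constructor
  · rw [mul_eq_one_comm]
    have h0' : R 0 * (R 0)ᵀ = 1 := by rw [mul_eq_one_comm]; exact h0.1
    rw [← h0']
    ext i j
    refine const_of_deriv (f := fun t => (R t * (R t)ᵀ) i j) ?_ t ht
    intro s hs
    have h := prod_entry (A := R) (B := fun t => (R t)ᵀ) (A' := R s * hat (Ω s)) (B' := (R s * hat (Ω s))ᵀ)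
      (mat_entry (hR s hs)) (fun i j => mat_entry (hR s hs) j i) i j
    convert h using 1
    rw [Matrix.transpose_mul, hat_transpose, Matrix.mul_assoc, ← Matrix.mul_add, Matrix.neg_mul]
    simp
  · rw [← det_one h0.1 h0.2]
    refine const_of_deriv (f := fun t => (R t).det) ?_ t ht
    intro s hs
    have e := mat_entry (hR s hs)
    simp only [Matrix.det_fin_three]
    have h := (((((((e 0 0).mul (e 1 1)).mul (e 2 2)).sub (((e 0 0).mul (e 1 2)).mul (e 2 1))).sub
      (((e 0 1).mul (e 1 0)).mul (e 2 2))).add (((e 0 1).mul (e 1 2)).mul (e 2 0))).add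
      (((e 0 2).mul (e 1 0)).mul (e 2 1))).sub (((e 0 2).mul (e 1 1)).mul (e 2 0))
    refine h.congr_deriv ?_
    simp [Matrix.mul_apply, Fin.sum_univ_three, hat]
    ring

def sv (E : Mat3) : Fin 3 → ℝ := vee (skewPart E)

def dot3 (u v : Fin 3 → ℝ) : ℝ := u 0 * v 0 + u 1 * v 1 + u 2 * v 2

theorem sv0 (E : Mat3) : sv E 0 = 2⁻¹ * (E 2 1 - E 1 2) := by simp [sv, vee, skewPart]
theorem sv1 (E : Mat3) : sv E 1 = 2⁻¹ * (E 0 2 - E 2 0) := by simp [sv, vee, skewPart]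
theorem sv2 (E : Mat3) : sv E 2 = 2⁻¹ * (E 1 0 - E 0 1) := by simp [sv, vee, skewPart]

theorem rot_adj {E : Mat3} (h : Eᵀ * E = 1) (hd : E.det = 1) : E.adjugate = Eᵀ := by
  have h1 : E * Eᵀ = 1 := by rw [mul_eq_one_comm]; exact h
  calc E.adjugate = E.adjugate * (E * Eᵀ) := by rw [h1, mul_one]
    _ = Eᵀ := by rw [← mul_assoc, Matrix.adjugate_mul, hd]; simp

theorem rot_s2 {E : Mat3} (h : Eᵀ * E = 1) (hd : E.det = 1) :
    dot3 (sv E) (sv E) = (3 - E.trace) - (3 - E.trace)^2/4 := by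
  have ha := rot_adj h hd
  have a0 := congrFun (congrFun ha 0) 0
  have a1 := congrFun (congrFun ha 1) 1
  have a2 := congrFun (congrFun ha 2) 2
  have d0 := congrFun (congrFun h 0) 0
  have d1 := congrFun (congrFun h 1) 1
  have d2 := congrFun (congrFun h 2) 2
  simp [Matrix.adjugate_fin_three] at a0 a1 a2
  simp [Matrix.mul_apply, Fin.sum_univ_three] at d0 d1 d2
  rw [dot3, sv0, sv1, sv2, Matrix.trace_fin_three]
  linear_combination (1/4) * (d0 + d1 + d2) + (1/2) * (a0 + a1 + a2)

theorem rot_entry {E : Mat3} (h : Eᵀ * E = 1) (i j : Fin 3) : |E i j| ≤ 1 := by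
  have d := congrFun (congrFun h j) j
  rw [Matrix.mul_apply, Matrix.one_apply_eq] at d
  apply abs_le_one_iff_mul_self_le_one.2
  rw [← d]
  exact Finset.single_le_sum (f := fun k => Eᵀ j k * E k j) (fun k _ => mul_self_nonneg (E k j)) (Finset.mem_univ i)

theorem rot_quad {E : Mat3} (h : Eᵀ * E = 1) (e : Fin 3 → ℝ) :
    2⁻¹ * (E.trace * dot3 e e - dot3 e (E *ᵥ e)) ≤ 3 * dot3 e e := by
  have hb : ∀ i j, -(E i j * (e i * e j)) ≤ (e i ^2 + e j ^2)/2 := by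
    intro i j
    have h1 := rot_entry h i j
    have : |E i j * (e i * e j)| ≤ (e i ^2 + e j ^2)/2 := by
      rw [abs_mul]
      calc |E i j| * |e i * e j| ≤ 1 * |e i * e j| := by gcongr
        _ ≤ _ := by
          rw [one_mul, abs_le]; constructor <;> nlinarith [sq_nonneg (e i - e j), sq_nonneg (e i + e j)]
    linarith [neg_abs_le (E i j * (e i * e j))]
  have ht : E.trace ≤ 3 := by
    rw [Matrix.trace_fin_three]
    linarith [(abs_le.1 (rot_entry h 0 0)).2, (abs_le.1 (rot_entry h 1 1)).2, (abs_le.1 (rot_entry h 2 2)).2]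
  have hn : 0 ≤ dot3 e e := by unfold dot3; nlinarith [sq_nonneg (e 0), sq_nonneg (e 1), sq_nonneg (e 2)]
  have h2 := mul_le_mul_of_nonneg_right ht hn
  have h3 : -dot3 e (E *ᵥ e) ≤ 3 * dot3 e e := by
    simp only [dot3, Matrix.mulVec, dotProduct, Fin.sum_univ_three]
    linarith [hb 0 0, hb 0 1, hb 0 2, hb 1 0, hb 1 1, hb 1 2, hb 2 0, hb 2 1, hb 2 2]
  linarith

theorem dot_cs (u v : Fin 3 → ℝ) : dot3 u v ^ 2 ≤ dot3 u u * dot3 v v := by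
  unfold dot3
  nlinarith [sq_nonneg (u 0 * v 1 - u 1 * v 0), sq_nonneg (u 0 * v 2 - u 2 * v 0), sq_nonneg (u 1 * v 2 - u 2 * v 1)]

theorem enorm3_eq (v : Fin 3 → ℝ) : enorm3 v = Real.sqrt (dot3 v v) := by
  unfold enorm3 dot3
  congr 1
  rw [Fin.sum_univ_three]; ring

theorem norm_eq {A B : Mat3} (hA : Aᵀ * A = 1) (hB : Bᵀ * B = 1) :
    ‖A - B‖ = Real.sqrt (2 * (3 - (Bᵀ * A).trace)) := by
  rw [Matrix.frobenius_norm_def, ← Real.sqrt_eq_rpow]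
  congr 1
  have a0 := congrArg Matrix.trace hA
  have b0 := congrArg Matrix.trace hB
  simp [Matrix.trace_fin_three, Matrix.mul_apply, Fin.sum_univ_three] at a0 b0 ⊢
  linear_combination a0 + b0

theorem main_ineq (kR p a p0 a0 x : ℝ) (hkR : 0 < kR) (hp : 0 ≤ p) (ha : 0 ≤ a) (hp0 : 0 ≤ p0) (ha0 : 0 ≤ a0)
    (h : a + kR * p ≤ 3 * Real.exp (2 * x) * (a0 + kR * p0)) :
    Real.sqrt (2 * p) + Real.sqrt a ≤
      Real.sqrt (3 * (4/kR + 2) * (1 + kR)) * Real.exp x * (Real.sqrt (2 * p0) + Real.sqrt a0) := by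
  refine (sq_le_sq₀ (by positivity) (by positivity)).1 ?_
  have s1 := Real.sq_sqrt (show 0 ≤ 2 * p by positivity)
  have s2 := Real.sq_sqrt ha
  have s3 := Real.sq_sqrt (show 0 ≤ 2 * p0 by positivity)
  have s4 := Real.sq_sqrt ha0
  have s5 : 0 ≤ Real.sqrt (2 * p0) * Real.sqrt a0 := by positivity
  rw [mul_pow, mul_pow, Real.sq_sqrt (by positivity), ← Real.exp_nat_mul]
  push_cast
  have e := Real.exp_pos (2 * x)
  have n0 : a0 + kR * p0 ≤ (1 + kR) * (Real.sqrt (2 * p0) + Real.sqrt a0)^2 := by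
    have : a0 + 2 * p0 ≤ (Real.sqrt (2 * p0) + Real.sqrt a0)^2 := by nlinarith
    refine le_trans ?_ (mul_le_mul_of_nonneg_left this (by positivity))
    nlinarith [mul_nonneg hkR.le ha0, mul_nonneg hkR.le hp0]
  have n1 : (Real.sqrt (2 * p) + Real.sqrt a)^2 ≤ (4/kR + 2) * (a + kR * p) := by
    have : (4/kR + 2) * (a + kR * p) = 4 * a / kR + 4 * p + 2 * a + 2 * kR * p := by field_simp; ring
    rw [this]
    have : 0 ≤ 4 * a / kR := by positivity
    have : 0 ≤ 2 * kR * p := by positivity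
    nlinarith [sq_nonneg (Real.sqrt (2 * p) - Real.sqrt a)]
  calc _ ≤ (4/kR + 2) * (a + kR * p) := n1
    _ ≤ (4/kR + 2) * (3 * Real.exp (2 * x) * (a0 + kR * p0)) := by gcongr
    _ ≤ (4/kR + 2) * (3 * Real.exp (2 * x) * ((1 + kR) * (Real.sqrt (2 * p0) + Real.sqrt a0)^2)) := by gcongr
    _ = _ := by ring

/-- Theorem 8 (with the feedback of Proposition 5): the controller
`u = u₀ − k_R Skew(R₀ᵀR)^∨ − k_Ω(Ω − Ω₀) + (Ω − Ω₀) × Ω₀` makes the fully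
actuated rigid body system `Ṙ = RΩ̂`, `Ω̇ = u` track the reference trajectory
`(R₀, Ω₀)` exponentially, locally around the reference. -/
theorem rigid_body_exponential_tracking
    (R₀ : ℝ → Mat3) (Ω₀ u₀ : ℝ → Fin 3 → ℝ)
    (hR₀SO3 : ∀ t, 0 ≤ t → R₀ t ∈ SO3)
    (hR₀ : ∀ t, 0 ≤ t → HasDerivAt R₀ (R₀ t * hat (Ω₀ t)) t)
    (hΩ₀ : ∀ t, 0 ≤ t → HasDerivAt Ω₀ (u₀ t) t)
    (hΩ₀bdd : ∃ M, ∀ t, 0 ≤ t → enorm3 (Ω₀ t) ≤ M)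
    (hu₀bdd : ∃ M, ∀ t, 0 ≤ t → enorm3 (u₀ t) ≤ M)
    (kR kΩ : ℝ) (hkR : 0 < kR) (hkΩ : 0 < kΩ) :
    ∃ δ > (0:ℝ), ∃ C > (0:ℝ), ∃ lam > (0:ℝ),
      ∀ (R : ℝ → Mat3) (Ω : ℝ → Fin 3 → ℝ),
        R 0 ∈ SO3 →
        (∀ t, 0 ≤ t → HasDerivAt R (R t * hat (Ω t)) t) →
        (∀ t, 0 ≤ t → HasDerivAt Ω
          (u₀ t - kR • vee (skewPart ((R₀ t)ᵀ * R t))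
            - kΩ • (Ω t - Ω₀ t) + cross (Ω t - Ω₀ t) (Ω₀ t)) t) →
        ‖R 0 - R₀ 0‖ + enorm3 (Ω 0 - Ω₀ 0) < δ →
        ∀ t, 0 ≤ t →
          ‖R t - R₀ t‖ + enorm3 (Ω t - Ω₀ t) ≤
            C * Real.exp (-lam * t) * (‖R 0 - R₀ 0‖ + enorm3 (Ω 0 - Ω₀ 0)) := by
  set ε := min (1/2) (min (kR/2) (kΩ/2/(3 + kΩ^2/(2*kR)))) with hε
  have hε0 : 0 < ε := by rw [hε]; positivity
  have h1 : ε ≤ 1/2 := min_le_left _ _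
  have h2 : ε ≤ kR/2 := (min_le_right _ _).trans (min_le_left _ _)
  have h3 : ε * (3 + kΩ^2/(2*kR)) ≤ kΩ/2 := by
    rw [← le_div_iff₀ (by positivity)]
    exact (min_le_right _ _).trans (min_le_right _ _)
  set c := min kΩ (ε/2) with hc
  have hc0 : 0 < c := by rw [hc]; positivity
  refine ⟨min 1 (kR/(1+kR)), by positivity, Real.sqrt (3 * (4/kR + 2) * (1 + kR)), by positivity, c/3, by positivity, ?_⟩
  intro R Ω hR0 hR hΩ hδ t ht
  have hSO := stays R Ω hR0 hR
  have hSO₀ : ∀ t, 0 ≤ t → (R₀ t)ᵀ * R₀ t = 1 := fun t ht => (hR₀SO3 t ht).1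
  have hE : ∀ t, 0 ≤ t → ((R₀ t)ᵀ * R t)ᵀ * ((R₀ t)ᵀ * R t) = 1 := by
    intro t ht
    have h' : R₀ t * (R₀ t)ᵀ = 1 := by rw [mul_eq_one_comm]; exact hSO₀ t ht
    rw [Matrix.transpose_mul, Matrix.transpose_transpose, Matrix.mul_assoc, ← Matrix.mul_assoc (R₀ t), h',
      Matrix.one_mul, (hSO t ht).1]
  have hEd : ∀ t, 0 ≤ t → ((R₀ t)ᵀ * R t).det = 1 := by
    intro t ht
    rw [Matrix.det_mul, Matrix.det_transpose, (hSO t ht).2, det_one (hSO₀ t ht) (hR₀SO3 t ht).2, one_mul]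
  have dE : ∀ t, 0 ≤ t → ∀ i j, HasDerivAt (fun t => ((R₀ t)ᵀ * R t) i j)
      (((R₀ t)ᵀ * R t * hat (Ω t) - hat (Ω₀ t) * ((R₀ t)ᵀ * R t)) i j) t := by
    intro t ht i j
    have h := prod_entry (A := fun t => (R₀ t)ᵀ) (B := R) (A' := (R₀ t * hat (Ω₀ t))ᵀ) (B' := R t * hat (Ω t))
      (fun i j => mat_entry (hR₀ t ht) j i) (mat_entry (hR t ht)) i j
    refine h.congr_deriv ?_
    rw [Matrix.transpose_mul, hat_transpose]
    simp only [Matrix.neg_mul, Matrix.mul_assoc]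
    rw [neg_add_eq_sub]
  have de : ∀ t, 0 ≤ t → ∀ i, HasDerivAt (fun t => (Ω t - Ω₀ t) i)
      ((- kR • sv ((R₀ t)ᵀ * R t) - kΩ • (Ω t - Ω₀ t) + cross (Ω t - Ω₀ t) (Ω₀ t)) i) t := by
    intro t ht i
    have h := (hasDerivAt_pi.1 (hΩ t ht) i).sub (hasDerivAt_pi.1 (hΩ₀ t ht) i)
    refine h.congr_deriv ?_
    simp [sv]
    ring
  have hp0 : ∀ t, 0 ≤ t → 0 ≤ 3 - ((R₀ t)ᵀ * R t).trace := by
    intro t ht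
    have h := hE t ht
    rw [Matrix.trace_fin_three]
    linarith [(abs_le.1 (rot_entry h 0 0)).2, (abs_le.1 (rot_entry h 1 1)).2, (abs_le.1 (rot_entry h 2 2)).2]
  have ha0 : ∀ t, 0 ≤ t → 0 ≤ dot3 (Ω t - Ω₀ t) (Ω t - Ω₀ t) := by
    intro t ht
    unfold dot3
    nlinarith [sq_nonneg ((Ω t - Ω₀ t) 0), sq_nonneg ((Ω t - Ω₀ t) 1), sq_nonneg ((Ω t - Ω₀ t) 2)]
  have hn : ∀ t, 0 ≤ t → ‖R t - R₀ t‖ + enorm3 (Ω t - Ω₀ t) =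
      Real.sqrt (2 * (3 - ((R₀ t)ᵀ * R t).trace)) + Real.sqrt (dot3 (Ω t - Ω₀ t) (Ω t - Ω₀ t)) := by
    intro t ht
    rw [norm_eq (hSO t ht).1 (hSO₀ t ht), enorm3_eq]
  rw [hn 0 le_rfl] at hδ
  rw [hn t ht, hn 0 le_rfl]
  apply main_ineq kR _ _ _ _ _ hkR (hp0 t ht) (ha0 t ht) (hp0 0 le_rfl) (ha0 0 le_rfl)
  rw [show 2 * (-(c/3) * t) = -(2*c/3) * t by ring]
  refine decay (fun t => 3 - ((R₀ t)ᵀ * R t).trace) (fun t => dot3 (Ω t - Ω₀ t) (Ω t - Ω₀ t))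
    (fun t => dot3 (sv ((R₀ t)ᵀ * R t)) (Ω t - Ω₀ t))
    (fun t => 2⁻¹ * (((R₀ t)ᵀ * R t).trace * dot3 (Ω t - Ω₀ t) (Ω t - Ω₀ t)
      - dot3 (Ω t - Ω₀ t) (((R₀ t)ᵀ * R t) *ᵥ (Ω t - Ω₀ t)))
      - kR * dot3 (sv ((R₀ t)ᵀ * R t)) (sv ((R₀ t)ᵀ * R t)) - kΩ * dot3 (sv ((R₀ t)ᵀ * R t)) (Ω t - Ω₀ t))
    (fun t => dot3 (sv ((R₀ t)ᵀ * R t)) (sv ((R₀ t)ᵀ * R t)))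
    kR kΩ hkR hkΩ ε c hε0 h1 h2 h3 hc0 (min_le_left _ _) (min_le_right _ _) ?_ ?_ ?_ ?_ ?_ hp0 ha0 ?_ ?_ t ht
  · intro t ht
    have E := dE t ht
    have h := (((E 0 0).add (E 1 1)).add (E 2 2)).const_sub 3
    simp only [Matrix.trace_fin_three]
    refine h.congr_deriv ?_
    generalize (R₀ t)ᵀ * R t = F
    rw [dot3, sv0, sv1, sv2]
    simp [Matrix.mul_apply, Fin.sum_univ_three, Matrix.vecMul, dotProduct, hat]
    ring
  · intro t ht
    have e := de t ht
    have h := (((e 0).mul (e 0)).add ((e 1).mul (e 1))).add ((e 2).mul (e 2))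
    refine HasDerivAt.congr_deriv h ?_
    generalize sv ((R₀ t)ᵀ * R t) = s
    simp [dot3, cross]
    ring
  · intro t ht
    have E := dE t ht
    have e := de t ht
    have h := (((((E 2 1).sub (E 1 2)).const_mul 2⁻¹).mul (e 0)).add ((((E 0 2).sub (E 2 0)).const_mul 2⁻¹).mul (e 1))).add
      ((((E 1 0).sub (E 0 1)).const_mul 2⁻¹).mul (e 2))
    simp only [dot3, sv0, sv1, sv2]
    refine HasDerivAt.congr_deriv h ?_
    simp only [Pi.add_apply, Pi.sub_apply, Pi.smul_apply, smul_eq_mul, sv0, sv1, sv2]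
    generalize (R₀ t)ᵀ * R t = F
    simp [Matrix.mul_apply, Fin.sum_univ_three, Matrix.vecMul, dotProduct, hat, cross, sv0, sv1, sv2, Matrix.trace_fin_three, Matrix.mulVec]
    ring
  · intro t ht
    have := rot_quad (hE t ht) (Ω t - Ω₀ t)
    linarith
  · intro t ht
    exact rot_s2 (hE t ht) (hEd t ht)
  · intro t ht
    exact dot_cs _ _
  · have hP := hp0 0 le_rfl
    have hA := ha0 0 le_rfl
    generalize 3 - ((R₀ 0)ᵀ * R 0).trace = p at *
    generalize dot3 (Ω 0 - Ω₀ 0) (Ω 0 - Ω₀ 0) = a at *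
    have d1 := hδ.trans_le (min_le_left _ _)
    have d2 := hδ.trans_le (min_le_right _ _)
    rw [lt_div_iff₀ (by positivity)] at d2
    have s1 := Real.sq_sqrt (show 0 ≤ 2 * p by positivity)
    have s2 := Real.sq_sqrt hA
    have n1 := Real.sqrt_nonneg (2 * p)
    have n2 := Real.sqrt_nonneg a
    have m1 : a ≤ Real.sqrt a := by nlinarith
    have m2 : 2 * p ≤ Real.sqrt (2 * p) := by nlinarith
    nlinarith [mul_nonneg hkR.le n1, mul_nonneg hkR.le n2, mul_le_mul_of_nonneg_left m2 hkR.le]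


end
end

section
/- Let k_e > 0 and let Ω₀ : [0,∞) → ℝ³ be continuous. Let K₀, K₁, K₂, K₃, K_I ∈ ℝ^{3×3} be such that the real polynomial λ ↦ det(λ⁵ I + λ⁴ K₃ + λ³ K₂ + λ² K₁ + λ K₀ + K_I) is Hurwitz, and let a₁, a₀, a_I be real numbers such that λ³ + a₁λ² + a₀λ + a_I is a Hurwitz polynomial. Then there exist constants C > 0 and μ > 0 such that every solution (Z_s, x, z) : [0,∞) → Sym(ℝ^{3×3}) × ℝ³ × ℝ of the closed-loop system Ż_s = [Z_s, Ω̂₀(t)] − 2k_e Z_s, x⁽⁴⁾(t) = −K₃ x⃛(t) − K₂ ẍ(t) − K₁ ẋ(t) − K₀ x(t) − K_I ∫₀ᵗ x(τ) dτ, z̈(t) = −a₁ ż(t) − a₀ z(t) − a_I ∫₀ᵗ z(τ) dτ, satisfies ‖Z_s(t)‖ + Σ_{j=0}^{3} ‖x⁽ʲ⁾(t)‖ + |z(t)| + |ż(t)| ≤ C·e^{−μt}·(‖Z_s(0)‖ + Σ_{j=0}^{3} ‖x⁽ʲ⁾(0)‖ + |z(0)| + |ż(0)|) for all t ≥ 0.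 -/
open Matrix

attribute [local instance] Matrix.frobeniusNormedAddCommGroup Matrix.frobeniusNormedSpace

noncomputable section

namespace P7
open Polynomial Set

theorem decay_multiset {E : Type*} [NormedAddCommGroup E] [NormedSpace ℂ E] [NormedSpace ℝ E]
    [IsScalarTower ℝ ℂ E] [FiniteDimensional ℂ E] (A : Module.End ℂ E) (μ : ℝ)
    (s : Multiset ℂ) : (∀ l ∈ s, l.re < -μ) → ∃ K : ℝ, 0 ≤ K ∧ ∀ y : ℝ → E,
      (∀ t, 0 ≤ t → HasDerivWithinAt y (A (y t)) (Ici 0) t) →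
      (∀ t, 0 ≤ t → aeval A ((s.map (fun l => X - C l)).prod) (y t) = 0) →
      ∀ t, 0 ≤ t → ‖y t‖ ≤ K * Real.exp (-μ * t) * ‖y 0‖ := by
  induction s using Multiset.induction_on with
  | empty =>
    intro _
    refine ⟨0, le_rfl, fun y _ h t ht => ?_⟩
    have := h t ht
    simp at this
    simp [this]
  | cons l s ih =>
    intro hs
    obtain ⟨K, hK, ih⟩ := ih (fun m hm => hs m (Multiset.mem_cons_of_mem hm))
    have hl : l.re < -μ := hs l (Multiset.mem_cons_self l s)
    set B : E →L[ℂ] E := LinearMap.toContinuousLinearMap (A - l • (1 : Module.End ℂ E)) with hB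
    have hBa : ∀ v, B v = A v - l • v := fun v => by simp [hB]
    set c : ℝ := -l.re - μ with hc
    have hc0 : 0 < c := by rw [hc]; linarith
    refine ⟨1 + K * ‖B‖ / c, by positivity, fun y hy hz t ht => ?_⟩
    have hu := ih (fun t => B (y t)) (fun t ht => by
      have h1 := (B.restrictScalars ℝ).hasFDerivAt.comp_hasDerivWithinAt t (hy t ht)
      have e : A (B (y t)) = (B.restrictScalars ℝ) (A (y t)) := by simp [hBa]
      rw [e]
      exact h1) (fun t ht => by
      have h1 := hz t ht
      rw [Multiset.map_cons, Multiset.prod_cons, mul_comm, map_mul] at h1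
      rw [Module.End.mul_apply] at h1
      convert h1 using 2
      simp [hBa, Algebra.algebraMap_eq_smul_one])
    set D : ℝ := K * ‖B‖ * ‖y 0‖ with hD
    have hD0 : 0 ≤ D := by positivity
    have hu' : ∀ t, 0 ≤ t → ‖B (y t)‖ ≤ D * Real.exp (-μ * t) := fun t ht => by
      refine (hu t ht).trans ?_
      have := B.le_opNorm (y 0)
      calc K * Real.exp (-μ * t) * ‖B (y 0)‖ ≤ K * Real.exp (-μ * t) * (‖B‖ * ‖y 0‖) := by gcongr
        _ = _ := by rw [hD]; ring
    have hnE : ∀ t : ℝ, ‖Complex.exp (-l * t)‖ = Real.exp (-l.re * t) := fun t => by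
      rw [Complex.norm_exp]; simp
    have hw : ∀ t : ℝ, 0 ≤ t → HasDerivWithinAt (fun t : ℝ => Complex.exp (-l * t) • y t)
        (Complex.exp (-l * t) • B (y t)) (Ici 0) t := fun t ht => by
      have h1 : HasDerivAt (fun t : ℝ => Complex.exp (-l * t)) (Complex.exp (-l * t) * (-l * 1)) t := by
        have := ((Complex.ofRealCLM.hasDerivAt (x := t)).const_mul (-l)).cexp
        simpa using this
      have h2 := h1.hasDerivWithinAt.smul (s := Ici 0) (hy t ht)
      refine HasDerivWithinAt.congr_deriv (f := fun t : ℝ => Complex.exp (-l * t) • y t) h2 ?_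
      rw [hBa]
      module
    have key := image_norm_le_of_norm_deriv_right_le_deriv_boundary' (a := 0) (b := t)
      (f := fun t : ℝ => Complex.exp (-l * t) • y t)
      (f' := fun t : ℝ => Complex.exp (-l * t) • B (y t))
      (B := fun t => ‖y 0‖ + D / c * Real.exp (c * t)) (B' := fun t => D * Real.exp (c * t))
      (fun τ hτ => ((hw τ hτ.1).mono Icc_subset_Ici_self).continuousWithinAt)
      (fun τ hτ => (hw τ hτ.1).mono (Ici_subset_Ici.2 hτ.1))
      (by simp; positivity)
      (by fun_prop)
      (fun τ hτ => by
        have h1 : HasDerivAt (fun t => ‖y 0‖ + D / c * Real.exp (c * t))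
          (D / c * (Real.exp (c * τ) * (c * 1))) τ :=
          ((((hasDerivAt_id τ).const_mul c).exp).const_mul (D / c)).const_add _
        have e : D * Real.exp (c * τ) = D / c * (Real.exp (c * τ) * (c * 1)) := by
          field_simp
        rw [e]
        exact h1.hasDerivWithinAt)
      (fun τ hτ => by
        rw [norm_smul, hnE]
        calc _ ≤ Real.exp (-l.re * τ) * (D * Real.exp (-μ * τ)) := by gcongr; exact hu' τ hτ.1
          _ = D * (Real.exp (-l.re * τ) * Real.exp (-μ * τ)) := by ring
          _ = _ := by rw [← Real.exp_add]; congr 2; rw [hc]; ring)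
      (right_mem_Icc.2 ht)
    simp only [norm_smul, hnE] at key
    have e1 : ‖y t‖ = Real.exp (l.re * t) * (Real.exp (-l.re * t) * ‖y t‖) := by
      rw [← mul_assoc, ← Real.exp_add]; simp
    rw [e1]
    have e2 : Real.exp (l.re * t) * Real.exp (c * t) = Real.exp (-μ * t) := by
      rw [← Real.exp_add]; congr 1; rw [hc]; ring
    have e3 : Real.exp (l.re * t) ≤ Real.exp (-μ * t) := by
      apply Real.exp_le_exp.2; nlinarith
    calc _ ≤ Real.exp (l.re * t) * (‖y 0‖ + D / c * Real.exp (c * t)) := by gcongr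
      _ = Real.exp (l.re * t) * ‖y 0‖ + D / c * (Real.exp (l.re * t) * Real.exp (c * t)) := by ring
      _ ≤ Real.exp (-μ * t) * ‖y 0‖ + D / c * Real.exp (-μ * t) := by rw [e2]; gcongr
      _ = _ := by rw [hD]; ring

theorem decay {E : Type*} [NormedAddCommGroup E] [NormedSpace ℂ E] [NormedSpace ℝ E]
    [IsScalarTower ℝ ℂ E] [FiniteDimensional ℂ E] (A : Module.End ℂ E)
    (hA : ∀ (l : ℂ) (v : E), v ≠ 0 → A v = l • v → l.re < 0) :
    ∃ μ : ℝ, 0 < μ ∧ ∃ K : ℝ, 0 ≤ K ∧ ∀ y : ℝ → E,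
      (∀ t, 0 ≤ t → HasDerivWithinAt y (A (y t)) (Ici 0) t) →
      ∀ t, 0 ≤ t → ‖y t‖ ≤ K * Real.exp (-μ * t) * ‖y 0‖ := by
  have hint : IsIntegral ℂ A := Algebra.IsIntegral.isIntegral A
  have hne := minpoly.ne_zero hint
  have hroots : ∀ l ∈ (minpoly ℂ A).roots, l.re < 0 := by
    intro l hl
    have h1 := (Module.End.hasEigenvalue_iff_isRoot (f := A) (μ := l)).2 (isRoot_of_mem_roots hl)
    obtain ⟨v, hv⟩ := h1.exists_hasEigenvector
    exact hA l v hv.2 hv.apply_eq_smul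
  have hmu : ∀ s : Multiset ℂ, (∀ l ∈ s, l.re < 0) → ∃ μ : ℝ, 0 < μ ∧ ∀ l ∈ s, l.re < -μ := by
    intro s
    induction s using Multiset.induction_on with
    | empty => intro _; exact ⟨1, one_pos, by simp⟩
    | cons l s ih =>
      intro h
      obtain ⟨μ, h0, h1⟩ := ih (fun m hm => h m (Multiset.mem_cons_of_mem hm))
      have hl := h l (Multiset.mem_cons_self l s)
      refine ⟨min μ (-l.re / 2), lt_min h0 (by linarith), fun m hm => ?_⟩
      rcases Multiset.mem_cons.1 hm with rfl | hm
      · have := min_le_right μ (-m.re / 2); linarith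
      · have := min_le_left μ (-l.re / 2); have := h1 m hm; linarith
  obtain ⟨μ, hμ, h⟩ := hmu _ hroots
  obtain ⟨K, hK, hh⟩ := decay_multiset A μ _ h
  refine ⟨μ, hμ, K, hK, fun y hy => hh y hy fun t ht => ?_⟩
  have hs := (IsAlgClosed.splits (minpoly ℂ A)).eq_prod_roots_of_monic (minpoly.monic hint)
  rw [← hs, minpoly.aeval]
  simp

theorem int_deriv {F : Type*} [NormedAddCommGroup F] [NormedSpace ℝ F] [CompleteSpace F]
    (x : ℝ → F) (hx : ContinuousOn x (Ici 0)) (t : ℝ) (ht : 0 ≤ t) :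
    HasDerivWithinAt (fun t => ∫ τ in (0:ℝ)..t, x τ) (x t) (Ici 0) t := by
  have hc : Continuous (fun s : ℝ => x (max s 0)) :=
    hx.comp_continuous (by fun_prop) (fun s => mem_Ici.2 (le_max_right _ _))
  have h1 := (hc.integral_hasStrictDerivAt 0 t).hasDerivAt.hasDerivWithinAt (s := Ici 0)
  have e : ∀ t ∈ Ici (0:ℝ), (∫ τ in (0:ℝ)..t, x τ) = ∫ τ in (0:ℝ)..t, x (max τ 0) := by
    intro t ht
    apply intervalIntegral.integral_congr
    intro s hs
    rw [uIcc_of_le ht] at hs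
    simp only
    rw [max_eq_left hs.1]
  have h2 := h1.congr e (e t ht)
  rwa [max_eq_left ht] at h2

def cM (K : Mat3) : Matrix (Fin 3) (Fin 3) ℂ := K.map Complex.ofReal

def cv (v : Fin 3 → ℝ) : Fin 3 → ℂ := fun i => (v i : ℂ)

theorem cM_cv (K : Mat3) (v : Fin 3 → ℝ) : cM K *ᵥ cv v = cv (K *ᵥ v) := by
  ext i
  simp [cM, cv, Matrix.mulVec, dotProduct]

theorem cv_deriv {x : ℝ → Fin 3 → ℝ} {x' : Fin 3 → ℝ} {s : Set ℝ} {t : ℝ}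
    (h : HasDerivWithinAt x x' s t) : HasDerivWithinAt (fun t => cv (x t)) (cv x') s t := by
  rw [hasDerivWithinAt_pi] at h ⊢
  intro i
  exact (h i).ofReal_comp

def Acomp (K₀ K₁ K₂ K₃ KI : Mat3) : Module.End ℂ (Fin 5 → Fin 3 → ℂ) where
  toFun v := ![v 1, v 2, v 3, v 4, -(cM K₃ *ᵥ v 4) - cM K₂ *ᵥ v 3 - cM K₁ *ᵥ v 2
    - cM K₀ *ᵥ v 1 - cM KI *ᵥ v 0]
  map_add' v w := by
    funext i
    fin_cases i <;> simp [Matrix.mulVec_add]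
    abel
  map_smul' c v := by
    funext i
    fin_cases i <;> simp [Matrix.mulVec_smul]
    module

theorem Acomp_eig (K₀ K₁ K₂ K₃ KI : Mat3)
    (hHur : IsHurwitzPoly
      (((X ^ 5 : ℝ[X]) • (1 : Matrix (Fin 3) (Fin 3) ℝ[X])
        + (X ^ 4 : ℝ[X]) • K₃.map C + (X ^ 3 : ℝ[X]) • K₂.map C
        + (X ^ 2 : ℝ[X]) • K₁.map C + (X : ℝ[X]) • K₀.map C + KI.map C).det))
    (l : ℂ) (v : Fin 5 → Fin 3 → ℂ) (hv : v ≠ 0) (h : Acomp K₀ K₁ K₂ K₃ KI v = l • v) :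
    l.re < 0 := by
  apply hHur
  have h0 : v 1 = l • v 0 := congrFun h 0
  have h1 : v 2 = l • v 1 := congrFun h 1
  have h2 : v 3 = l • v 2 := congrFun h 2
  have h3 : v 4 = l • v 3 := congrFun h 3
  have h4 : -(cM K₃ *ᵥ v 4) - cM K₂ *ᵥ v 3 - cM K₁ *ᵥ v 2
    - cM K₀ *ᵥ v 1 - cM KI *ᵥ v 0 = l • v 4 := congrFun h 4
  have hv0 : v 0 ≠ 0 := by
    intro hv0
    apply hv
    funext i
    fin_cases i <;> simp [h3, h2, h1, h0, hv0]
  set L : Matrix (Fin 3) (Fin 3) ℂ := l ^ 5 • 1 + l ^ 4 • cM K₃ + l ^ 3 • cM K₂ + l ^ 2 • cM K₁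
    + l • cM K₀ + cM KI with hL
  have hLv : L *ᵥ v 0 = 0 := by
    rw [h3, h2, h1, h0] at h4
    simp only [hL, Matrix.add_mulVec, Matrix.smul_mulVec, Matrix.one_mulVec]
    simp only [Matrix.mulVec_smul] at h4
    linear_combination (norm := module) (-1 : ℂ) • h4
  have hdet : L.det = 0 := Matrix.exists_mulVec_eq_zero_iff.1 ⟨v 0, hv0, hLv⟩
  rw [Polynomial.eval_map, ← Polynomial.coe_eval₂RingHom, RingHom.map_det, ← hdet]
  congr 1
  ext i j
  rw [hL]
  by_cases hij : i = j <;> simp [cM, hij] <;> ring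

theorem enorm3_le {v : Fin 3 → ℝ} {M : ℝ} (hM : 0 ≤ M) (h : ∀ i, |v i| ≤ M) :
    enorm3 v ≤ 2 * M := by
  unfold enorm3
  apply Real.sqrt_le_iff.2 ⟨by positivity, ?_⟩
  have := fun i => sq_le_sq' (abs_le.1 (h i)).1 (abs_le.1 (h i)).2
  rw [Fin.sum_univ_three]
  nlinarith [this 0, this 1, this 2]

theorem le_enorm3 (v : Fin 3 → ℝ) (i : Fin 3) : |v i| ≤ enorm3 v := by
  unfold enorm3
  apply Real.abs_le_sqrt
  exact Finset.single_le_sum (f := fun i => v i ^ 2) (fun _ _ => sq_nonneg _) (Finset.mem_univ i)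

theorem enorm3_nonneg (v : Fin 3 → ℝ) : 0 ≤ enorm3 v := Real.sqrt_nonneg _

theorem xdecay (K₀ K₁ K₂ K₃ KI : Mat3)
    (hHur : IsHurwitzPoly
      (((X ^ 5 : ℝ[X]) • (1 : Matrix (Fin 3) (Fin 3) ℝ[X])
        + (X ^ 4 : ℝ[X]) • K₃.map C + (X ^ 3 : ℝ[X]) • K₂.map C
        + (X ^ 2 : ℝ[X]) • K₁.map C + (X : ℝ[X]) • K₀.map C + KI.map C).det)) :
    ∃ μ : ℝ, 0 < μ ∧ ∃ K : ℝ, 0 ≤ K ∧ ∀ (x x1 x2 x3 : ℝ → Fin 3 → ℝ),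
        (∀ t, 0 ≤ t → HasDerivAt x (x1 t) t) →
        (∀ t, 0 ≤ t → HasDerivAt x1 (x2 t) t) →
        (∀ t, 0 ≤ t → HasDerivAt x2 (x3 t) t) →
        (∀ t, 0 ≤ t → HasDerivAt x3
          (-(K₃.mulVec (x3 t)) - K₂.mulVec (x2 t) - K₁.mulVec (x1 t)
            - K₀.mulVec (x t) - KI.mulVec (∫ τ in (0:ℝ)..t, x τ)) t) →
        ∀ t, 0 ≤ t →
          (enorm3 (x t) + enorm3 (x1 t) + enorm3 (x2 t) + enorm3 (x3 t)) ≤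
            K * Real.exp (-μ * t) *
              (enorm3 (x 0) + enorm3 (x1 0) + enorm3 (x2 0) + enorm3 (x3 0)) := by
  obtain ⟨μ, hμ, K, hK, H⟩ := decay (Acomp K₀ K₁ K₂ K₃ KI) (Acomp_eig K₀ K₁ K₂ K₃ KI hHur)
  refine ⟨μ, hμ, 8 * K, by positivity, fun x x1 x2 x3 hx hx1 hx2 hx3 t ht => ?_⟩
  have hxc : ContinuousOn x (Ici 0) := fun t ht => (hx t ht).continuousAt.continuousWithinAt
  have hy := H (fun t => ![cv (∫ τ in (0:ℝ)..t, x τ), cv (x t), cv (x1 t), cv (x2 t), cv (x3 t)])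
    (fun t ht => by
      rw [hasDerivWithinAt_pi]
      intro i
      fin_cases i
      · exact cv_deriv (int_deriv x hxc t ht)
      · exact cv_deriv (hx t ht).hasDerivWithinAt
      · exact cv_deriv (hx1 t ht).hasDerivWithinAt
      · exact cv_deriv (hx2 t ht).hasDerivWithinAt
      · refine (cv_deriv (hx3 t ht).hasDerivWithinAt).congr_deriv ?_
        simp [Acomp, cM_cv]
        ext i
        simp [cv]) t ht
  set S := enorm3 (x 0) + enorm3 (x1 0) + enorm3 (x2 0) + enorm3 (x3 0) with hS
  have n0 := enorm3_nonneg (x 0)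
  have n1 := enorm3_nonneg (x1 0)
  have n2 := enorm3_nonneg (x2 0)
  have n3 := enorm3_nonneg (x3 0)
  have hS0 : 0 ≤ S := by positivity
  set M := K * Real.exp (-μ * t) * S with hM
  have hM0 : 0 ≤ M := by positivity
  have h0 : ‖(![cv (∫ τ in (0:ℝ)..0, x τ), cv (x 0), cv (x1 0), cv (x2 0), cv (x3 0)] :
      Fin 5 → Fin 3 → ℂ)‖ ≤ S := by
    rw [pi_norm_le_iff_of_nonneg hS0]
    intro i
    rw [pi_norm_le_iff_of_nonneg hS0]
    intro j
    have m0 := le_enorm3 (x 0) j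
    have m1 := le_enorm3 (x1 0) j
    have m2 := le_enorm3 (x2 0) j
    have m3 := le_enorm3 (x3 0) j
    fin_cases i <;> simp [cv] <;> linarith
  have hy' := hy.trans (mul_le_mul_of_nonneg_left h0 (by positivity))
  rw [← hM, pi_norm_le_iff_of_nonneg hM0] at hy'
  have q : ∀ i j, _ := fun i => (pi_norm_le_iff_of_nonneg hM0).1 (hy' i)
  have q0 : enorm3 (x t) ≤ 2 * M := enorm3_le hM0 fun j => by simpa [cv] using q 1 j
  have q1 : enorm3 (x1 t) ≤ 2 * M := enorm3_le hM0 fun j => by simpa [cv] using q 2 j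
  have q2 : enorm3 (x2 t) ≤ 2 * M := enorm3_le hM0 fun j => by simpa [cv] using q 3 j
  have q3 : enorm3 (x3 t) ≤ 2 * M := enorm3_le hM0 fun j => by simpa [cv] using q 4 j
  calc _ ≤ 8 * M := by linarith
    _ = _ := by rw [hM]; ring

def Az (a₀ a₁ aI : ℝ) : Module.End ℂ (Fin 3 → ℂ) where
  toFun v := ![v 1, v 2, -(a₁ * v 2) - a₀ * v 1 - aI * v 0]
  map_add' v w := by
    funext i
    fin_cases i <;> simp
    ring
  map_smul' c v := by
    funext i
    fin_cases i <;> simp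
    ring

theorem zdecay (a₀ a₁ aI : ℝ)
    (hHur' : IsHurwitzPoly
      ((X : ℝ[X]) ^ 3 + C a₁ * X ^ 2 + C a₀ * X + C aI)) :
    ∃ μ : ℝ, 0 < μ ∧ ∃ K : ℝ, 0 ≤ K ∧ ∀ (z z1 : ℝ → ℝ),
        (∀ t, 0 ≤ t → HasDerivAt z (z1 t) t) →
        (∀ t, 0 ≤ t → HasDerivAt z1
          (-(a₁ * z1 t) - a₀ * z t - aI * ∫ τ in (0:ℝ)..t, z τ) t) →
        ∀ t, 0 ≤ t →
          |z t| + |z1 t| ≤ K * Real.exp (-μ * t) * (|z 0| + |z1 0|) := by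
  obtain ⟨μ, hμ, K, hK, H⟩ := decay (Az a₀ a₁ aI) (fun l v hv h => by
    apply hHur'
    have h0 : v 1 = l * v 0 := congrFun h 0
    have h1 : v 2 = l * v 1 := congrFun h 1
    have h2 : -(a₁ * v 2) - a₀ * v 1 - aI * v 0 = l * v 2 := congrFun h 2
    have hv0 : v 0 ≠ 0 := by
      intro hv0
      apply hv
      funext i
      fin_cases i <;> simp [h1, h0, hv0]
    apply mul_right_cancel₀ hv0
    rw [h1, h0] at h2
    simp only [Polynomial.map_add, Polynomial.map_mul, Polynomial.map_pow, map_X, map_C, eval_add, eval_mul,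
      eval_pow, eval_X, eval_C, Complex.coe_algebraMap]
    linear_combination -h2)
  refine ⟨μ, hμ, 2 * K, by positivity, fun z z1 hz hz1 t ht => ?_⟩
  have hzc : ContinuousOn z (Ici 0) := fun t ht => (hz t ht).continuousAt.continuousWithinAt
  have hy := H (fun t => ![((∫ τ in (0:ℝ)..t, z τ : ℝ) : ℂ), (z t : ℂ), (z1 t : ℂ)])
    (fun t ht => by
      rw [hasDerivWithinAt_pi]
      intro i
      fin_cases i
      · exact (int_deriv z hzc t ht).ofReal_comp
      · exact (hz t ht).hasDerivWithinAt.ofReal_comp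
      · refine (hz1 t ht).hasDerivWithinAt.ofReal_comp.congr_deriv ?_
        simp [Az]) t ht
  set S := |z 0| + |z1 0| with hS
  have hS0 : 0 ≤ S := by positivity
  have n0 := abs_nonneg (z 0)
  have n1 := abs_nonneg (z1 0)
  set M := K * Real.exp (-μ * t) * S with hM
  have hM0 : 0 ≤ M := by positivity
  have h0 : ‖(![((∫ τ in (0:ℝ)..0, z τ : ℝ) : ℂ), (z 0 : ℂ), (z1 0 : ℂ)] : Fin 3 → ℂ)‖ ≤ S := by
    rw [pi_norm_le_iff_of_nonneg hS0]
    intro i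
    fin_cases i <;> simp <;> linarith
  have hy' := hy.trans (mul_le_mul_of_nonneg_left h0 (by positivity))
  rw [← hM, pi_norm_le_iff_of_nonneg hM0] at hy'
  have q0 : |z t| ≤ M := by simpa using hy' 1
  have q1 : |z1 t| ≤ M := by simpa using hy' 2
  calc _ ≤ 2 * M := by linarith
    _ = _ := by rw [hM]; ring

theorem frob_sq (Z : Mat3) : ‖Z‖ ^ 2 = ∑ i, ∑ j, Z i j ^ 2 := by
  rw [Matrix.frobenius_norm_def, ← Real.sqrt_eq_rpow, Real.sq_sqrt (by positivity)]
  simp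

theorem Zdecay (ke : ℝ) (Ω₀ : ℝ → Fin 3 → ℝ) (Zs : ℝ → Mat3)
    (hZ : ∀ t, 0 ≤ t →
          HasDerivAt Zs (mcomm (Zs t) (hat (Ω₀ t)) - (2 * ke) • Zs t) t) (t : ℝ) (ht : 0 ≤ t) :
    ‖Zs t‖ ≤ Real.exp (-(2 * ke) * t) * ‖Zs 0‖ := by
  have hent : ∀ t, 0 ≤ t → ∀ i j, HasDerivAt (fun t => Zs t i j)
      ((mcomm (Zs t) (hat (Ω₀ t)) - (2 * ke) • Zs t) i j) t := fun t ht i j =>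
    (LinearMap.toContinuousLinearMap
      (Matrix.entryLinearMap ℝ ℝ i j : Mat3 →ₗ[ℝ] ℝ)).hasFDerivAt.comp_hasDerivAt t (hZ t ht)
  have hg : ∀ t, 0 ≤ t → HasDerivAt
      (fun t => Real.exp (4 * ke * t) * ∑ i, ∑ j, Zs t i j ^ 2) 0 t := fun t ht => by
    have h1 : HasDerivAt (fun t => ∑ i, ∑ j, Zs t i j ^ 2) (∑ i, ∑ j,
        ((2:ℕ) * Zs t i j ^ (2 - 1) * (mcomm (Zs t) (hat (Ω₀ t)) - (2 * ke) • Zs t) i j)) t :=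
      HasDerivAt.fun_sum fun i _ => HasDerivAt.fun_sum fun j _ => (hent t ht i j).fun_pow 2
    have h2 : HasDerivAt (fun t => Real.exp (4 * ke * t))
      (Real.exp (4 * ke * t) * (4 * ke * 1)) t := ((hasDerivAt_id t).const_mul (4 * ke)).exp
    have h3 := h2.fun_mul h1
    refine h3.congr_deriv ?_
    simp [Fin.sum_univ_three, mcomm, hat, Matrix.mul_apply, Matrix.sub_apply, Matrix.vecMul, dotProduct]
    ring
  have hconst := constant_of_has_deriv_right_zero (a := 0) (b := t)
    (f := fun t => Real.exp (4 * ke * t) * ∑ i, ∑ j, Zs t i j ^ 2)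
    (fun s hs => (hg s hs.1).continuousAt.continuousWithinAt)
    (fun s hs => (hg s hs.1).hasDerivWithinAt) t (right_mem_Icc.2 ht)
  simp only [← frob_sq] at hconst
  refine (sq_le_sq₀ (by positivity) (by positivity)).1 ?_
  rw [mul_pow]
  have : ‖Zs 0‖ ^ 2 = Real.exp (4 * ke * t) * ‖Zs t‖ ^ 2 := by
    rw [hconst]; simp
  rw [this, ← mul_assoc, ← Real.exp_nat_mul, ← Real.exp_add]
  apply le_of_eq
  have : ((2:ℕ):ℝ) * (-(2 * ke) * t) + 4 * ke * t = 0 := by push_cast; ring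
  rw [this]
  simp

end P7

open Polynomial in
/-- Proposition 7: the PID-like feedback with integral terms exponentially
stabilizes the origin of the feedback-transformed linearized quadcopter
tracking error system together with the transversal `Z_s` dynamics. -/
theorem prop7_quadcopter_PID_exp_stabilization (ke : ℝ) (hke : 0 < ke)
    (Ω₀ : ℝ → Fin 3 → ℝ) (hΩ₀cont : ContinuousOn Ω₀ (Set.Ici 0))
    (K₀ K₁ K₂ K₃ KI : Mat3)
    (hHur : IsHurwitzPoly
      (((X ^ 5 : ℝ[X]) • (1 : Matrix (Fin 3) (Fin 3) ℝ[X])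
        + (X ^ 4 : ℝ[X]) • K₃.map C + (X ^ 3 : ℝ[X]) • K₂.map C
        + (X ^ 2 : ℝ[X]) • K₁.map C + (X : ℝ[X]) • K₀.map C + KI.map C).det))
    (a₀ a₁ aI : ℝ)
    (hHur' : IsHurwitzPoly
      ((X : ℝ[X]) ^ 3 + C a₁ * X ^ 2 + C a₀ * X + C aI)) :
    ∃ Cst > (0:ℝ), ∃ μ > (0:ℝ),
      ∀ (Zs : ℝ → Mat3) (x x1 x2 x3 : ℝ → Fin 3 → ℝ) (z z1 : ℝ → ℝ),
        (∀ t, 0 ≤ t → (Zs t)ᵀ = Zs t) →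
        (∀ t, 0 ≤ t →
          HasDerivAt Zs (mcomm (Zs t) (hat (Ω₀ t)) - (2 * ke) • Zs t) t) →
        (∀ t, 0 ≤ t → HasDerivAt x (x1 t) t) →
        (∀ t, 0 ≤ t → HasDerivAt x1 (x2 t) t) →
        (∀ t, 0 ≤ t → HasDerivAt x2 (x3 t) t) →
        (∀ t, 0 ≤ t → HasDerivAt x3
          (-(K₃.mulVec (x3 t)) - K₂.mulVec (x2 t) - K₁.mulVec (x1 t)
            - K₀.mulVec (x t) - KI.mulVec (∫ τ in (0:ℝ)..t, x τ)) t) →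
        (∀ t, 0 ≤ t → HasDerivAt z (z1 t) t) →
        (∀ t, 0 ≤ t → HasDerivAt z1
          (-(a₁ * z1 t) - a₀ * z t - aI * ∫ τ in (0:ℝ)..t, z τ) t) →
        ∀ t, 0 ≤ t →
          ‖Zs t‖ + (enorm3 (x t) + enorm3 (x1 t) + enorm3 (x2 t) + enorm3 (x3 t))
              + |z t| + |z1 t| ≤
            Cst * Real.exp (-μ * t) *
              (‖Zs 0‖ + (enorm3 (x 0) + enorm3 (x1 0) + enorm3 (x2 0)
                + enorm3 (x3 0)) + |z 0| + |z1 0|) := by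
  obtain ⟨μ₁, hμ₁, L₁, hL₁, H₁⟩ := P7.xdecay K₀ K₁ K₂ K₃ KI hHur
  obtain ⟨μ₂, hμ₂, L₂, hL₂, H₂⟩ := P7.zdecay a₀ a₁ aI hHur'
  refine ⟨1 + L₁ + L₂, by positivity, min (2 * ke) (min μ₁ μ₂), by positivity, ?_⟩
  intro Zs x x1 x2 x3 z z1 _ hZ hx hx1 hx2 hx3 hz hz1 t ht
  have b0 := P7.Zdecay ke Ω₀ Zs hZ t ht
  have b1 := H₁ x x1 x2 x3 hx hx1 hx2 hx3 t ht
  have b2 := H₂ z z1 hz hz1 t ht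
  set μ := min (2 * ke) (min μ₁ μ₂) with hμ
  have l0 : μ ≤ 2 * ke := min_le_left _ _
  have l1 : μ ≤ μ₁ := (min_le_right _ _).trans (min_le_left _ _)
  have l2 : μ ≤ μ₂ := (min_le_right _ _).trans (min_le_right _ _)
  have e0 : Real.exp (-(2 * ke) * t) ≤ Real.exp (-μ * t) := Real.exp_le_exp.2 (by nlinarith)
  have e1 : Real.exp (-μ₁ * t) ≤ Real.exp (-μ * t) := Real.exp_le_exp.2 (by nlinarith)
  have e2 : Real.exp (-μ₂ * t) ≤ Real.exp (-μ * t) := Real.exp_le_exp.2 (by nlinarith)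
  have n0 := norm_nonneg (Zs 0)
  have n1 : 0 ≤ enorm3 (x 0) + enorm3 (x1 0) + enorm3 (x2 0) + enorm3 (x3 0) := by
    have := P7.enorm3_nonneg (x 0)
    have := P7.enorm3_nonneg (x1 0)
    have := P7.enorm3_nonneg (x2 0)
    have := P7.enorm3_nonneg (x3 0)
    positivity
  have n2 : 0 ≤ |z 0| + |z1 0| := by positivity
  set N := enorm3 (x 0) + enorm3 (x1 0) + enorm3 (x2 0) + enorm3 (x3 0)
  have hE := Real.exp_pos (-μ * t)
  set E := Real.exp (-μ * t)
  have c0 : ‖Zs t‖ ≤ E * ‖Zs 0‖ := b0.trans (by gcongr)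
  have c1 := b1.trans (show _ ≤ L₁ * E * N by gcongr)
  have c2 := b2.trans (show _ ≤ L₂ * E * (|z 0| + |z1 0|) by gcongr)
  set W := |z 0| + |z1 0| with hW
  have hsum : ‖Zs 0‖ + N + |z 0| + |z1 0| = ‖Zs 0‖ + N + W := by rw [hW]; ring
  rw [hsum]
  have p0 : 0 ≤ E * N := by positivity
  have p1 : 0 ≤ E * W := by positivity
  have p2 : 0 ≤ E * ‖Zs 0‖ := by positivity
  have := mul_nonneg hL₁ p1
  have := mul_nonneg hL₁ p2
  have := mul_nonneg hL₂ p0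
  have := mul_nonneg hL₂ p2
  linarith

end
end
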